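/- Let i and j be real numbers with 0 < i, j < 1 and i + j = 1, and let θ = (γ, δ) ∈ ℝ². Let I ⊂ ℝ be a compact interval with nonempty interior and let f : ℝ → ℝ be twice continuously differentiable on I with f″(x) ≠ 0 for every x ∈ I. Then the Hausdorff dimension of the set Bad_θ(i,j) ∩ {(x, f(x)) : x ∈ I} equals 1. -/

import Mathlib

open Filter Set

/-- Distance from a real number to the nearest integer. -/
noncomputable def distNearestInt (t : ℝ) : ℝ := |t - round t|

/-- The inhomogeneous set `Bad_θ(i,j)` of `(i,j)`-badly approximable pairs. -/
def badPair (i j : ℝ) (θ : ℝ × ℝ) : Set (ℝ × ℝ) :=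
  {p : ℝ × ℝ | ∃ c : ℝ, 0 < c ∧ ∀ q : ℕ, 0 < q →
    c / (q : ℝ) < max (distNearestInt ((q : ℝ) * p.1 - θ.1) ^ (1 / i))
                      (distNearestInt ((q : ℝ) * p.2 - θ.2) ^ (1 / j))}

/-- closed dyadic interval -/
def dyI (n k : ℕ) : Set ℝ := Icc ((k : ℝ) / 2 ^ n) (((k : ℝ) + 1) / 2 ^ n)

lemma dyI_sub (n k : ℕ) : dyI (n + 1) k ⊆ dyI n (k / 2) := by
  intro x hx
  obtain ⟨h1, h2⟩ := hx
  have hp : (0 : ℝ) < 2 ^ n := by positivity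
  rw [pow_succ] at h1 h2
  rw [div_le_iff₀ (by positivity)] at h1
  rw [le_div_iff₀ (by positivity)] at h2
  have e1 : 2 * (k / 2) ≤ k := Nat.mul_div_le k 2
  have e2 : k + 1 ≤ 2 * (k / 2) + 2 := by omega
  have e1' : (2 : ℝ) * ((k / 2 : ℕ) : ℝ) ≤ k := by exact_mod_cast e1
  have e2' : (k : ℝ) + 1 ≤ 2 * ((k / 2 : ℕ) : ℝ) + 2 := by exact_mod_cast e2
  constructor
  · rw [div_le_iff₀ hp]; linarith
  · rw [le_div_iff₀ hp]; linarith

lemma dyI_sub' (n d k : ℕ) : dyI (n + d) k ⊆ dyI n (k / 2 ^ d) := by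
  induction d generalizing k with
  | zero => simp
  | succ d ih =>
    refine (dyI_sub (n + d) k).trans ((ih (k / 2)).trans ?_)
    rw [Nat.div_div_eq_div_mul, pow_succ, mul_comm]

/-- the removal predicate -/
def remP {ι : Type} (K : ℕ → Finset ι) (B : ℕ → ι → Set ℝ) (cov : ℕ → ℕ → Prop) (N k : ℕ) : Prop :=
  (∃ κ ∈ K N, (dyI N k ∩ B N κ).Nonempty) ∨ cov N k

open Classical in
/-- surviving intervals -/
noncomputable def surv {ι : Type} (K : ℕ → Finset ι) (B : ℕ → ι → Set ℝ) (cov : ℕ → ℕ → Prop) :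
    ℕ → Finset ℕ
  | 0 => {0}
  | n + 1 => (((surv K B cov n) ×ˢ (Finset.range 2)).image (fun p => 2 * p.1 + p.2)).filter
      (fun k => ¬ remP K B cov (n + 1) k)

section
variable {ι : Type} (K : ℕ → Finset ι) (B : ℕ → ι → Set ℝ) (cov : ℕ → ℕ → Prop)

lemma surv_succ_mem {n k : ℕ} (h : k ∈ surv K B cov (n + 1)) :
    k / 2 ∈ surv K B cov n ∧ ¬ remP K B cov (n + 1) k := by
  simp only [surv, Finset.mem_filter, Finset.mem_image, Finset.mem_product, Finset.mem_range,
    Prod.exists] at h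
  obtain ⟨⟨a, b, ⟨ha, hb⟩, rfl⟩, h2⟩ := h
  refine ⟨?_, h2⟩
  have : (2 * a + b) / 2 = a := by omega
  rwa [this]

lemma surv_anc (n d k : ℕ) (h : k ∈ surv K B cov (n + d)) : k / 2 ^ d ∈ surv K B cov n := by
  induction d generalizing k with
  | zero => simpa using h
  | succ d ih =>
    have := ih (k / 2) (surv_succ_mem K B cov h).1
    rw [Nat.div_div_eq_div_mul] at this
    rwa [pow_succ, mul_comm]

lemma surv_lt {n k : ℕ} (h : k ∈ surv K B cov n) : k < 2 ^ n := by
  induction n generalizing k with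
  | zero => simp [surv] at h; simp [h]
  | succ n ih =>
    have := ih (surv_succ_mem K B cov h).1
    rw [pow_succ]; omega

lemma surv_disj {l k N : ℕ} (h : k ∈ surv K B cov l) (hN1 : 1 ≤ N) (hN : N ≤ l) (κ : ι)
    (hκ : κ ∈ K N) : Disjoint (dyI l k) (B N κ) := by
  obtain ⟨d, rfl⟩ := Nat.exists_eq_add_of_le hN
  have h1 := surv_anc K B cov N d k h
  obtain ⟨N', rfl⟩ := Nat.exists_eq_add_of_le' hN1
  have h2 := (surv_succ_mem K B cov h1).2
  rw [Set.disjoint_left]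
  intro x hx hxB
  exact h2 (Or.inl ⟨κ, hκ, x, dyI_sub' _ _ _ hx, hxB⟩)

lemma card_le_of_sep (s : Finset ℕ) (N : ℕ) (S : Set ℝ)
    (hs : ∀ k ∈ s, (dyI N k ∩ S).Nonempty)
    (hS : ∀ u1 ∈ S, ∀ u2 ∈ S, ∀ u3 ∈ S, ∀ u4 ∈ S, u1 + 1 / 2 ^ N ≤ u2 → u2 + 1 / 2 ^ N ≤ u3 →
      u3 + 1 / 2 ^ N ≤ u4 → False) : s.card ≤ 7 := by
  by_contra hcon
  push Not at hcon
  obtain ⟨t, hts, htc⟩ := Finset.exists_subset_card_eq hcon.le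
  set f := t.orderEmbOfFin htc with hf
  have hm : ∀ a, f a ∈ s := fun a => hts (Finset.orderEmbOfFin_mem t htc a)
  have hlt : ∀ a b : Fin 7, a < b → f a < f b := fun a b h => f.strictMono h
  have key : ∀ k ∈ s, ∃ x, x ∈ dyI N k ∧ x ∈ S := fun k hk => hs k hk
  have sep : ∀ k l : ℕ, ∀ x y : ℝ, x ∈ dyI N k → y ∈ dyI N l → k + 2 ≤ l → x + 1 / 2 ^ N ≤ y := by
    intro k l x y hx hy hkl
    have h1 := hx.2
    have h2 := hy.1
    have h3 : (k : ℝ) + 2 ≤ l := by exact_mod_cast hkl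
    have hp : (0 : ℝ) < 2 ^ N := by positivity
    have : ((k : ℝ) + 2) / 2 ^ N ≤ l / 2 ^ N := by gcongr
    have e : ((k : ℝ) + 2) / 2 ^ N = (k + 1) / 2 ^ N + 1 / 2 ^ N := by ring
    linarith
  obtain ⟨x0, h0, g0⟩ := key _ (hm 0)
  obtain ⟨x2, h2, g2⟩ := key _ (hm 2)
  obtain ⟨x4, h4, g4⟩ := key _ (hm 4)
  obtain ⟨x6, h6, g6⟩ := key _ (hm 6)
  have a1 := hlt 0 1 (by decide)
  have a2 := hlt 1 2 (by decide)
  have a3 := hlt 2 3 (by decide)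
  have a4 := hlt 3 4 (by decide)
  have a5 := hlt 4 5 (by decide)
  have a6 := hlt 5 6 (by decide)
  exact hS x0 g0 x2 g2 x4 g4 x6 g6 (sep _ _ _ _ h0 h2 (by omega)) (sep _ _ _ _ h2 h4 (by omega))
    (sep _ _ _ _ h4 h6 (by omega))

open Classical in
lemma surv_count (l : ℕ → ι → ℕ) (lam η : ℝ) (hlam : 1 ≤ lam)
    (hl : ∀ N, ∀ κ ∈ K N, l N κ < N)
    (hsep : ∀ N, ∀ κ ∈ K N, ∀ k < 2 ^ (l N κ),
      (∀ N' ≤ l N κ, ∀ κ' ∈ K N', Disjoint (dyI (l N κ) k) (B N' κ')) →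
      ∀ u1 ∈ B N κ ∩ dyI (l N κ) k, ∀ u2 ∈ B N κ ∩ dyI (l N κ) k,
      ∀ u3 ∈ B N κ ∩ dyI (l N κ) k, ∀ u4 ∈ B N κ ∩ dyI (l N κ) k,
      u1 + 1 / 2 ^ N ≤ u2 → u2 + 1 / 2 ^ N ≤ u3 → u3 + 1 / 2 ^ N ≤ u4 → False)
    (hsum : ∀ N, ∑ κ ∈ K N, 7 * (lam⁻¹) ^ (N - 1 - l N κ) ≤ η)
    (hη : 2 * η ≤ 2 - lam)
    (hcov : ∀ N, ((((Finset.range (2 ^ (N + 1))).filter (fun k => cov (N + 1) k)).card : ℕ) : ℝ)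
      ≤ η * lam ^ N) (n : ℕ) :
    lam ^ n ≤ ((surv K B cov n).card : ℝ) ∧
    ∀ m ≤ n, ((surv K B cov m).card : ℝ) ≤ (lam⁻¹) ^ (n - m) * ((surv K B cov n).card : ℝ) := by
  have hlam0 : 0 < lam := by linarith
  induction n with
  | zero =>
    refine ⟨by simp [surv], ?_⟩
    intro m hm
    obtain rfl : m = 0 := by omega
    simp
  | succ n ih =>
    obtain ⟨ih1, ih2⟩ := ih
    set S := surv K B cov with hS
    set C := ((S n) ×ˢ (Finset.range 2)).image (fun p : ℕ × ℕ => 2 * p.1 + p.2) with hC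
    have hCcard : C.card = 2 * (S n).card := by
      rw [hC, Finset.card_image_of_injOn, Finset.card_product, Finset.card_range, mul_comm]
      rintro ⟨a, b⟩ h ⟨a', b'⟩ h' e
      simp only [Finset.coe_product, Set.mem_prod, Finset.mem_coe, Finset.mem_range] at h h' e
      ext <;> simp only <;> omega
    have hCmem : ∀ k ∈ C, k / 2 ∈ S n := by
      intro k hk
      simp only [hC, Finset.mem_image, Finset.mem_product, Finset.mem_range, Prod.exists] at hk
      obtain ⟨a, b, ⟨ha, hb⟩, rfl⟩ := hk
      have : (2 * a + b) / 2 = a := by omega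
      rwa [this]
    have hCanc : ∀ m ≤ n, ∀ k ∈ C, k / 2 ^ (n + 1 - m) ∈ S m := by
      intro m hm k hk
      obtain ⟨d, rfl⟩ := Nat.exists_eq_add_of_le hm
      have := surv_anc K B cov m d (k / 2) (hCmem k hk)
      rw [Nat.div_div_eq_div_mul] at this
      have e : m + d + 1 - m = d + 1 := by omega
      rw [e, pow_succ, mul_comm]; exact this
    have hsplit : C.card = (C.filter (fun k => remP K B cov (n + 1) k)).card + (S (n + 1)).card := by
      rw [← Finset.card_filter_add_card_filter_not (s := C) (fun k => remP K B cov (n + 1) k)]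
      rfl
    have hκ : ∀ κ ∈ K (n + 1), (((C.filter (fun k => (dyI (n + 1) k ∩ B (n + 1) κ).Nonempty)).card : ℕ) : ℝ)
        ≤ 7 * (lam⁻¹) ^ (n + 1 - 1 - l (n + 1) κ) * (S n).card := by
      intro κ hκ
      have hln : l (n + 1) κ ≤ n := by have := hl _ κ hκ; omega
      have h1 : (C.filter (fun k => (dyI (n + 1) k ∩ B (n + 1) κ).Nonempty)).card ≤
          7 * (S (l (n + 1) κ)).card := by
        apply Finset.card_le_mul_card_image_of_maps_to
          (f := fun k => k / 2 ^ (n + 1 - l (n + 1) κ))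
        · intro k hk
          exact hCanc _ hln k (Finset.mem_filter.1 hk).1
        · intro b hb
          apply card_le_of_sep _ (n + 1) (B (n + 1) κ ∩ dyI (l (n + 1) κ) b)
          · intro k hk
            simp only [Finset.mem_filter] at hk
            obtain ⟨⟨hkC, x, hx1, hx2⟩, rfl⟩ := hk
            refine ⟨x, hx1, hx2, ?_⟩
            apply dyI_sub' _ (n + 1 - l (n + 1) κ) k
            have : l (n + 1) κ + (n + 1 - l (n + 1) κ) = n + 1 := by omega
            rwa [this]
          · apply hsep (n + 1) κ hκ b (surv_lt K B cov hb)
            intro N' hN' κ' hκ'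
            have : 1 ≤ N' := by have := hl _ κ' hκ'; omega
            exact surv_disj K B cov hb this hN' κ' hκ'
      have h2 := ih2 _ hln
      have h1' : (((C.filter (fun k => (dyI (n + 1) k ∩ B (n + 1) κ).Nonempty)).card : ℕ) : ℝ) ≤
          7 * ((S (l (n + 1) κ)).card : ℝ) := by exact_mod_cast h1
      have e : n + 1 - 1 - l (n + 1) κ = n - l (n + 1) κ := by omega
      rw [e]
      calc _ ≤ _ := h1'
        _ ≤ 7 * ((lam⁻¹) ^ (n - l (n + 1) κ) * (S n).card) := by gcongr
        _ = _ := by ring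
    have hrem : (((C.filter (fun k => remP K B cov (n + 1) k)).card : ℕ) : ℝ) ≤
        2 * η * (S n).card := by
      have hsub : C.filter (fun k => remP K B cov (n + 1) k) ⊆
          (K (n + 1)).biUnion (fun κ => C.filter (fun k => (dyI (n + 1) k ∩ B (n + 1) κ).Nonempty)) ∪
          (Finset.range (2 ^ (n + 1))).filter (fun k => cov (n + 1) k) := by
        intro k hk
        simp only [Finset.mem_filter] at hk
        obtain ⟨hkC, h | h⟩ := hk
        · obtain ⟨κ, h1, h2⟩ := h
          apply Finset.mem_union_left
          simp only [Finset.mem_biUnion, Finset.mem_filter]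
          exact ⟨κ, h1, hkC, h2⟩
        · apply Finset.mem_union_right
          simp only [Finset.mem_filter, Finset.mem_range]
          refine ⟨?_, h⟩
          have := surv_lt K B cov (hCmem k hkC)
          rw [pow_succ]; omega
      have c1 := Finset.card_le_card hsub
      have c2 := c1.trans (Finset.card_union_le _ _)
      have c3 := c2.trans (Nat.add_le_add_right Finset.card_biUnion_le _)
      have c4 : (((C.filter (fun k => remP K B cov (n + 1) k)).card : ℕ) : ℝ) ≤
        ∑ κ ∈ K (n + 1), (((C.filter (fun k => (dyI (n + 1) k ∩ B (n + 1) κ).Nonempty)).card : ℕ) : ℝ)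
        + ((((Finset.range (2 ^ (n + 1))).filter (fun k => cov (n + 1) k)).card : ℕ) : ℝ) := by
        exact_mod_cast c3
      have c5 := Finset.sum_le_sum hκ
      rw [← Finset.sum_mul] at c5
      have c6 := hsum (n + 1)
      have c7 := hcov n
      have hη0 : 0 ≤ η := by
        refine le_trans ?_ (hsum 0)
        apply Finset.sum_nonneg; intro κ _; positivity
      have c8 : η * lam ^ n ≤ η * (S n).card := by gcongr
      have c9 : (∑ κ ∈ K (n + 1), 7 * (lam⁻¹) ^ (n + 1 - 1 - l (n + 1) κ)) * ((S n).card : ℝ) ≤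
        η * (S n).card := by gcongr
      linarith
    have hstep : lam * (S n).card ≤ ((S (n + 1)).card : ℝ) := by
      have e1 : ((C.card : ℕ) : ℝ) = 2 * (S n).card := by rw [hCcard]; push_cast; ring
      have e2 : ((C.card : ℕ) : ℝ) = ((C.filter (fun k => remP K B cov (n + 1) k)).card : ℝ)
          + ((S (n + 1)).card : ℝ) := by rw [hsplit]; push_cast; ring
      have : (0 : ℝ) ≤ (S n).card := by positivity
      nlinarith
    refine ⟨?_, ?_⟩
    · calc lam ^ (n + 1) = lam * lam ^ n := by ring
        _ ≤ lam * (S n).card := by gcongr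
        _ ≤ _ := hstep
    · intro m hm
      rcases Nat.lt_or_ge m (n + 1) with h | h
      · have h1 := ih2 m (by omega)
        have e : n + 1 - m = (n - m) + 1 := by omega
        rw [e, pow_succ, mul_assoc]
        refine h1.trans ?_
        have : ((S n).card : ℝ) ≤ lam⁻¹ * (S (n + 1)).card := by
          rw [inv_mul_eq_div, le_div_iff₀ hlam0]; linarith
        gcongr
      · obtain rfl : m = n + 1 := by omega
        simp

lemma surv_exists (hne : ∀ n, (surv K B cov n).Nonempty) :
    ∃ x ∈ Icc (0 : ℝ) 1, ∀ N, ∃ k, k ∈ surv K B cov N ∧ x ∈ dyI N k := by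
  have := IsCompact.nonempty_iInter_of_sequence_nonempty_isCompact_isClosed
    (fun n => ⋃ k ∈ surv K B cov n, dyI n k) ?_ ?_ ?_ ?_
  · obtain ⟨x, hx⟩ := this
    simp only [mem_iInter, mem_iUnion] at hx
    refine ⟨x, ?_, fun N => ?_⟩
    · obtain ⟨k, hk, h⟩ := hx 0
      simp [surv] at hk
      simpa [hk, dyI] using h
    · obtain ⟨k, hk, h⟩ := hx N
      exact ⟨k, hk, h⟩
  · intro n
    refine iUnion₂_subset fun k hk => ?_
    exact (dyI_sub n k).trans (subset_biUnion_of_mem (u := fun k => dyI n k) (surv_succ_mem K B cov hk).1)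
  · intro n
    obtain ⟨k, hk⟩ := hne n
    refine ⟨(k : ℝ) / 2 ^ n, mem_biUnion hk ⟨le_refl _, by gcongr; linarith⟩⟩
  · exact (surv K B cov 0).isCompact_biUnion fun k _ => isCompact_Icc
  · intro n
    exact ((surv K B cov n).isCompact_biUnion fun k _ => isCompact_Icc).isClosed
end

lemma exists_level (s : ℝ) (hs : 0 < s) (hs1 : s < 1) (δ : ℝ) (h0 : 0 ≤ δ) (h1 : δ ≤ 1) (ε : ℝ) (hε : 0 < ε) :
    ∃ m : ℕ, δ ≤ (1 / 2) ^ m ∧ ((2 : ℝ) ^ s)⁻¹ ^ m ≤ 2 * δ ^ s + ε := by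
  have hp : (0 : ℝ) < 2 ^ s := by positivity
  have hlt : (1 : ℝ) < 2 ^ s := Real.one_lt_rpow (by norm_num) hs
  rcases h0.eq_or_lt with h | h
  · subst h
    obtain ⟨m, hm⟩ := exists_pow_lt_of_lt_one hε (inv_lt_one_of_one_lt₀ hlt)
    refine ⟨m, by positivity, ?_⟩
    rw [Real.zero_rpow hs.ne']
    linarith
  · obtain ⟨m, hm1, hm2⟩ := exists_nat_pow_near_of_lt_one h h1 (y := (1 / 2 : ℝ)) (by norm_num) (by norm_num)
    refine ⟨m, hm2, ?_⟩
    have a1 : ((1 / 2 : ℝ) ^ (m + 1)) ^ s ≤ δ ^ s := by gcongr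
    have a2 : ((1 / 2 : ℝ) ^ (m + 1)) ^ s = ((2 : ℝ) ^ s)⁻¹ ^ (m + 1) := by
      rw [← Real.rpow_natCast, ← Real.rpow_mul (by norm_num), mul_comm, Real.rpow_mul (by norm_num),
        Real.rpow_natCast]
      congr 1
      rw [one_div, Real.inv_rpow (by norm_num)]
    rw [a2, pow_succ] at a1
    have a3 : (2 : ℝ) ^ s ≤ 2 := by
      calc (2 : ℝ) ^ s ≤ 2 ^ (1 : ℝ) := Real.rpow_le_rpow_of_exponent_le (by norm_num) hs1.le
        _ = 2 := by simp
    have a4 : (2⁻¹ : ℝ) ≤ ((2 : ℝ) ^ s)⁻¹ := by gcongr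
    have a5 : (0 : ℝ) ≤ ((2 : ℝ) ^ s)⁻¹ ^ m := by positivity
    nlinarith

open MeasureTheory in
open Classical in
theorem cantor_hausdorff {ι : Type} (K : ℕ → Finset ι) (B : ℕ → ι → Set ℝ) (l : ℕ → ι → ℕ)
    (s η : ℝ) (hs : 0 < s) (hs1 : s < 1) (hη0 : 0 < η)
    (hl : ∀ N, ∀ κ ∈ K N, l N κ < N)
    (hsep : ∀ N, ∀ κ ∈ K N, ∀ k < 2 ^ (l N κ),
      (∀ N' ≤ l N κ, ∀ κ' ∈ K N', Disjoint (dyI (l N κ) k) (B N' κ')) →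
      ∀ u1 ∈ B N κ ∩ dyI (l N κ) k, ∀ u2 ∈ B N κ ∩ dyI (l N κ) k,
      ∀ u3 ∈ B N κ ∩ dyI (l N κ) k, ∀ u4 ∈ B N κ ∩ dyI (l N κ) k,
      u1 + 1 / 2 ^ N ≤ u2 → u2 + 1 / 2 ^ N ≤ u3 → u3 + 1 / 2 ^ N ≤ u4 → False)
    (hsum : ∀ N, ∑ κ ∈ K N, 7 * (((2 : ℝ) ^ s)⁻¹) ^ (N - 1 - l N κ) ≤ η)
    (hη : 2 * η ≤ 2 - (2 : ℝ) ^ s) :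
    μH[s] {u : ℝ | u ∈ Icc (0 : ℝ) 1 ∧ ∀ N, ∀ κ ∈ K N, u ∉ B N κ} ≠ 0 := by
  intro hzero
  set lam : ℝ := (2 : ℝ) ^ s with hlam
  have hlam1 : 1 < lam := Real.one_lt_rpow (by norm_num) hs
  have hlam2 : lam ≤ 2 := by linarith
  set A : Set ℝ := {u : ℝ | u ∈ Icc (0 : ℝ) 1 ∧ ∀ N, ∀ κ ∈ K N, u ∉ B N κ} with hA
  rw [Measure.hausdorffMeasure_apply] at hzero
  set ε : ℝ := η / 42 with hε
  have hε0 : 0 < ε := by positivity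
  have hε1 : ε < 1 / 84 := by
    rw [hε]; linarith
  obtain ⟨t, htA, htd, hts⟩ : ∃ t : ℕ → Set ℝ, A ⊆ ⋃ n, t n ∧ (∀ n, Metric.ediam (t n) ≤ 1) ∧
      ∑' n, ⨆ (_ : (t n).Nonempty), Metric.ediam (t n) ^ s < ENNReal.ofReal ε := by
    have h1 : (⨅ t : ℕ → Set ℝ, ⨅ (_ : A ⊆ ⋃ n, t n), ⨅ (_ : ∀ (n : ℕ), Metric.ediam (t n) ≤ 1),
        ∑' (n : ℕ), ⨆ (_ : (t n).Nonempty), Metric.ediam (t n) ^ s) ≤ 0 := by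
      rw [← hzero]
      exact le_iSup₂_of_le (f := fun (r : ENNReal) (_ : 0 < r) => ⨅ t : ℕ → Set ℝ, ⨅ (_ : A ⊆ ⋃ n, t n), ⨅ (_ : ∀ (n : ℕ), Metric.ediam (t n) ≤ r),
        ∑' (n : ℕ), ⨆ (_ : (t n).Nonempty), Metric.ediam (t n) ^ s) 1 (by norm_num) le_rfl
    have h2 := lt_of_le_of_lt h1 (ENNReal.ofReal_pos.2 hε0)
    simp only [iInf_lt_iff] at h2
    obtain ⟨t, a, b, c⟩ := h2
    exact ⟨t, a, b, c⟩
  set δ : ℕ → ℝ := fun n => (Metric.ediam (t n)).toReal with hδ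
  have hfin : ∀ n, Metric.ediam (t n) ≠ ⊤ := fun n => ne_top_of_le_ne_top (by simp) (htd n)
  have hδ0 : ∀ n, 0 ≤ δ n := fun n => ENNReal.toReal_nonneg
  have hδ1 : ∀ n, δ n ≤ 1 := fun n => by
    have := ENNReal.toReal_mono (by simp) (htd n)
    simpa using this
  have hsumδ : ∀ F : Finset ℕ, (∀ n ∈ F, (t n).Nonempty) → ∑ n ∈ F, δ n ^ s ≤ ε := by
    intro F hF
    have h1 : ∑ n ∈ F, ENNReal.ofReal (δ n ^ s) ≤ ENNReal.ofReal ε := by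
      calc ∑ n ∈ F, ENNReal.ofReal (δ n ^ s)
          ≤ ∑ n ∈ F, ⨆ (_ : (t n).Nonempty), Metric.ediam (t n) ^ s := by
            apply Finset.sum_le_sum
            intro n hn
            refine le_iSup_of_le (hF n hn) ?_
            rw [← ENNReal.ofReal_rpow_of_nonneg (hδ0 n) hs.le, hδ]
            simp only
            rw [ENNReal.ofReal_toReal (hfin n)]
        _ ≤ _ := ENNReal.sum_le_tsum F
        _ ≤ _ := hts.le
    rw [← ENNReal.ofReal_sum_of_nonneg (fun n _ => Real.rpow_nonneg (hδ0 n) _)] at h1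
    exact (ENNReal.ofReal_le_ofReal_iff hε0.le).1 h1
  choose m hm1 hm2 using fun n => exists_level s hs hs1 (δ n) (hδ0 n) (hδ1 n) (ε * (1 / 2) ^ (n + 1))
    (by positivity)
  have hsum2 : ∀ F : Finset ℕ, (∀ n ∈ F, (t n).Nonempty) → ∑ n ∈ F, lam⁻¹ ^ m n ≤ 3 * ε := by
    intro F hF
    have h1 : ∑ n ∈ F, (1 / 2 : ℝ) ^ (n + 1) ≤ 1 := by
      have h := (hasSum_geometric_two' 1)
      have h' := sum_le_hasSum F (fun n _ => by positivity) h
      refine le_trans (le_of_eq ?_) h'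
      apply Finset.sum_congr rfl
      intro n _
      rw [pow_succ, one_div, inv_pow]; ring
    calc ∑ n ∈ F, lam⁻¹ ^ m n ≤ ∑ n ∈ F, (2 * δ n ^ s + ε * (1 / 2) ^ (n + 1)) :=
          Finset.sum_le_sum fun n _ => hm2 n
      _ = 2 * ∑ n ∈ F, δ n ^ s + ε * ∑ n ∈ F, (1 / 2 : ℝ) ^ (n + 1) := by
          rw [Finset.sum_add_distrib, Finset.mul_sum, Finset.mul_sum]
      _ ≤ 2 * ε + ε * 1 := by
          have := hsumδ F hF
          gcongr
      _ = 3 * ε := by ring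
  have hdist : ∀ n, ∀ x ∈ t n, ∀ y ∈ t n, |x - y| ≤ (1 / 2) ^ m n := by
    intro n x hx y hy
    refine le_trans ?_ (hm1 n)
    have h1 := Metric.edist_le_ediam_of_mem hx hy
    have h2 := ENNReal.toReal_mono (hfin n) h1
    rwa [edist_dist, ENNReal.toReal_ofReal dist_nonneg, Real.dist_eq] at h2
  set cov : ℕ → ℕ → Prop := fun N k => ∃ n, (t n).Nonempty ∧ m n = N ∧ (dyI N k ∩ t n).Nonempty
    with hcovdef
  have hcov : ∀ N, ((((Finset.range (2 ^ (N + 1))).filter (fun k => cov (N + 1) k)).card : ℕ) : ℝ)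
      ≤ η * lam ^ N := by
    intro N
    set C := (Finset.range (2 ^ (N + 1))).filter (fun k => cov (N + 1) k) with hC
    have hg : ∀ k, ∃ n, k ∈ C → ((t n).Nonempty ∧ m n = N + 1 ∧ (dyI (N + 1) k ∩ t n).Nonempty) := by
      intro k
      by_cases hk : k ∈ C
      · obtain ⟨n, hn⟩ := (Finset.mem_filter.1 hk).2
        exact ⟨n, fun _ => hn⟩
      · exact ⟨0, fun h => absurd h hk⟩
    choose g hg using hg
    have h1 : C.card ≤ 7 * (C.image g).card := by
      apply Finset.card_le_mul_card_image_of_maps_to (f := g)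
      · intro k hk; exact Finset.mem_image_of_mem _ hk
      · intro n hn
        apply card_le_of_sep _ (N + 1) (t n)
        · intro k hk
          obtain ⟨hk1, rfl⟩ := Finset.mem_filter.1 hk
          exact (hg k hk1).2.2
        · intro u1 h1 u2 h2 u3 h3 u4 h4 a b c
          obtain ⟨k, hk, rfl⟩ := Finset.mem_image.1 hn
          have h5 := hdist _ u1 h1 u4 h4
          rw [(hg k hk).2.1] at h5
          have h6 := (abs_le.1 h5).1
          have h7 : (1 / 2 : ℝ) ^ (N + 1) = 1 / 2 ^ (N + 1) := by rw [one_div_pow]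
          have h8 : (0 : ℝ) < 1 / 2 ^ (N + 1) := by positivity
          linarith
    have h2 := hsum2 (C.image g) (by
      intro n hn
      obtain ⟨k, hk, rfl⟩ := Finset.mem_image.1 hn
      exact (hg k hk).1)
    have h3 : ∑ n ∈ C.image g, lam⁻¹ ^ m n = (C.image g).card * lam⁻¹ ^ (N + 1) := by
      rw [← nsmul_eq_mul, ← Finset.sum_const]
      apply Finset.sum_congr rfl
      intro n hn
      obtain ⟨k, hk, rfl⟩ := Finset.mem_image.1 hn
      rw [(hg k hk).2.1]
    rw [h3, inv_pow, ← div_eq_mul_inv, div_le_iff₀ (by positivity)] at h2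
    have h4 : (C.card : ℝ) ≤ 7 * (C.image g).card := by exact_mod_cast h1
    have h5 : (0 : ℝ) ≤ lam ^ N := by positivity
    calc (C.card : ℝ) ≤ 7 * (3 * ε * lam ^ (N + 1)) := by linarith
      _ = η / 2 * lam * lam ^ N := by rw [hε]; ring
      _ ≤ η * lam ^ N := by
        apply mul_le_mul_of_nonneg_right _ h5
        nlinarith
  have hne : ∀ n, (surv K B cov n).Nonempty := by
    intro n
    have := (surv_count K B cov l lam η hlam1.le hl hsep hsum hη hcov n).1
    rw [← Finset.card_pos]
    have h2 : (0 : ℝ) < lam ^ n := by positivity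
    exact_mod_cast lt_of_lt_of_le h2 this
  obtain ⟨x, hx01, hx⟩ := surv_exists K B cov hne
  have hxA : x ∈ A := by
    refine ⟨hx01, ?_⟩
    intro N κ hκ hxB
    obtain ⟨k, hk, hxk⟩ := hx N
    have h1 : 1 ≤ N := by have := hl _ κ hκ; omega
    exact Set.disjoint_left.1 (surv_disj K B cov hk h1 le_rfl κ hκ) hxk hxB
  obtain ⟨n, hn⟩ := mem_iUnion.1 (htA hxA)
  obtain ⟨k, hk, hxk⟩ := hx (m n)
  have hmn : m n ≠ 0 := by
    intro h
    have := hsum2 {n} (by intro a ha; rw [Finset.mem_singleton.1 ha]; exact ⟨x, hn⟩)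
    simp [h] at this
    linarith
  obtain ⟨N', hN'⟩ := Nat.exists_eq_succ_of_ne_zero hmn
  rw [hN'] at hk hxk
  exact (surv_succ_mem K B cov hk).2 (Or.inr ⟨n, ⟨x, hn⟩, hN', x, hxk, hn⟩)

/-- `(A,B,C)` is a dual vector attached to the rational point `(p/q, r/q)`. -/
def Dv (i j : ℝ) (q : ℕ) (p r A B C : ℤ) : Prop :=
  (A ≠ 0 ∨ B ≠ 0) ∧ A * p + B * r + C * q = 0 ∧ |(A : ℝ)| ≤ (q : ℝ) ^ i ∧ |(B : ℝ)| ≤ (q : ℝ) ^ j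

/-- minimal attached dual vector -/
def MDv (i j : ℝ) (q : ℕ) (p r A B C : ℤ) : Prop :=
  Dv i j q p r A B C ∧ ∀ A' B' C', Dv i j q p r A' B' C' → |A| + |B| ≤ |A'| + |B'|

def Red (q : ℕ) (p r : ℤ) : Prop :=
  ∀ (q' : ℕ) (p' r' : ℤ), 0 < q' → (q' : ℤ) * p = q * p' → (q' : ℤ) * r = q * r' → q ≤ q'

lemma exists_Dv (i j : ℝ) (hi : 0 < i) (hj : 0 < j) (hij : i + j = 1) (q : ℕ) (hq : 0 < q) (p r : ℤ) :
    ∃ A B C : ℤ, Dv i j q p r A B C := by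
  have hq0 : (0 : ℝ) < q := by exact_mod_cast hq
  set a := ⌊(q : ℝ) ^ i⌋₊ with ha
  set b := ⌊(q : ℝ) ^ j⌋₊ with hb
  have h1 : (q : ℝ) ^ i < a + 1 := Nat.lt_floor_add_one _
  have h2 : (q : ℝ) ^ j < b + 1 := Nat.lt_floor_add_one _
  have h3 : q < (a + 1) * (b + 1) := by
    have : (q : ℝ) < (a + 1) * (b + 1) := by
      calc (q : ℝ) = (q : ℝ) ^ i * (q : ℝ) ^ j := by rw [← Real.rpow_add hq0, hij, Real.rpow_one]
        _ < _ := by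
          apply mul_lt_mul'' h1 h2 <;> positivity
    exact_mod_cast this
  have ha' : (a : ℝ) ≤ (q : ℝ) ^ i := Nat.floor_le (by positivity)
  have hb' : (b : ℝ) ≤ (q : ℝ) ^ j := Nat.floor_le (by positivity)
  obtain ⟨⟨x, y⟩, hx, ⟨x', y'⟩, hx', hne, heq⟩ := Finset.exists_ne_map_eq_of_card_lt_of_maps_to
    (s := Finset.range (a + 1) ×ˢ Finset.range (b + 1)) (t := Finset.range q)
    (f := fun z => (((z.1 : ℤ) * p + (z.2 : ℤ) * r) % (q : ℤ)).toNat) (by simpa using h3) (by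
      intro z _
      have := Int.emod_lt_of_pos ((z.1 : ℤ) * p + (z.2 : ℤ) * r) (b := (q : ℤ)) (by exact_mod_cast hq)
      have h0 := Int.emod_nonneg ((z.1 : ℤ) * p + (z.2 : ℤ) * r) (b := (q : ℤ)) (by positivity)
      simp only [Finset.coe_range, mem_Iio]
      omega)
  simp only [Finset.mem_product, Finset.mem_range] at hx hx' heq
  have hmod : ((x : ℤ) * p + (y : ℤ) * r) % (q : ℤ) = ((x' : ℤ) * p + (y' : ℤ) * r) % (q : ℤ) := by
    have g0 := Int.emod_nonneg ((x : ℤ) * p + (y : ℤ) * r) (b := (q : ℤ)) (by positivity)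
    have g1 := Int.emod_nonneg ((x' : ℤ) * p + (y' : ℤ) * r) (b := (q : ℤ)) (by positivity)
    omega
  obtain ⟨C, hC⟩ := (Int.ModEq.dvd hmod :
    (q : ℤ) ∣ ((x' : ℤ) * p + (y' : ℤ) * r) - ((x : ℤ) * p + (y : ℤ) * r))
  refine ⟨(x' : ℤ) - x, (y' : ℤ) - y, -C, ?_, ?_, ?_, ?_⟩
  · by_contra hcon
    push Not at hcon
    apply hne
    ext <;> simp only <;> omega
  · linear_combination hC
  · refine le_trans ?_ ha'
    push_cast
    have e1 : (x : ℝ) ≤ a := by exact_mod_cast Nat.lt_succ_iff.1 hx.1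
    have e2 : (x' : ℝ) ≤ a := by exact_mod_cast Nat.lt_succ_iff.1 hx'.1
    have e3 : (0 : ℝ) ≤ x := by positivity
    have e4 : (0 : ℝ) ≤ x' := by positivity
    rw [abs_le]; constructor <;> linarith
  · refine le_trans ?_ hb'
    push_cast
    have e1 : (y : ℝ) ≤ b := by exact_mod_cast Nat.lt_succ_iff.1 hx.2
    have e2 : (y' : ℝ) ≤ b := by exact_mod_cast Nat.lt_succ_iff.1 hx'.2
    have e3 : (0 : ℝ) ≤ y := by positivity
    have e4 : (0 : ℝ) ≤ y' := by positivity
    rw [abs_le]; constructor <;> linarith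

lemma exists_MDv (i j : ℝ) (hi : 0 < i) (hj : 0 < j) (hij : i + j = 1) (q : ℕ) (p r : ℤ) :
    ∃ v : ℤ × ℤ × ℤ, 0 < q → MDv i j q p r v.1 v.2.1 v.2.2 := by
  rcases Nat.eq_zero_or_pos q with hq | hq
  · exact ⟨0, fun h => absurd h (by omega)⟩
  classical
  have hex : ∃ n : ℕ, ∃ A B C : ℤ, Dv i j q p r A B C ∧ A.natAbs + B.natAbs = n := by
    obtain ⟨A, B, C, h⟩ := exists_Dv i j hi hj hij q hq p r
    exact ⟨_, A, B, C, h, rfl⟩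
  obtain ⟨A, B, C, h, hn⟩ := Nat.find_spec hex
  refine ⟨(A, B, C), fun _ => ⟨h, ?_⟩⟩
  intro A' B' C' h'
  have := Nat.find_min' hex ⟨A', B', C', h', rfl⟩
  simp only [Int.abs_eq_natAbs]
  rw [← hn] at this
  omega

lemma parallel_eq {i j : ℝ} {q1 q2 : ℕ} {p1 r1 p2 r2 A1 B1 C1 A2 B2 C2 : ℤ}
    (h1 : MDv i j q1 p1 r1 A1 B1 C1) (h2 : MDv i j q2 p2 r2 A2 B2 C2)
    (hAB : A1 * B2 = A2 * B1) (hAC : A1 * C2 = A2 * C1) (hBC : B1 * C2 = B2 * C1) :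
    (∀ x y : ℝ, |A1 * x + B1 * y + C1| = |A2 * x + B2 * y + C2|) ∧
    (∀ w : ℝ, |A1 + B1 * w| = |A2 + B2 * w|) := by
  -- one sided statement
  have key : ∀ {q1 q2 : ℕ} {p1 r1 p2 r2 A1 B1 C1 A2 B2 C2 : ℤ},
      MDv i j q1 p1 r1 A1 B1 C1 → MDv i j q2 p2 r2 A2 B2 C2 → A1 * B2 = A2 * B1 →
      A1 * C2 = A2 * C1 → B1 * C2 = B2 * C1 → |A1| + |B1| ≤ |A2| + |B2| →
      |A1| = |A2| ∧ |B1| = |B2| := by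
    intro q1 q2 p1 r1 p2 r2 A1 B1 C1 A2 B2 C2 h1 h2 hAB hAC hBC hle
    have hABa : |A1| * |B2| = |A2| * |B1| := by rw [← abs_mul, ← abs_mul, hAB]
    have nA1 := abs_nonneg A1
    have nA2 := abs_nonneg A2
    have nB1 := abs_nonneg B1
    have nB2 := abs_nonneg B2
    have hA : |A1| ≤ |A2| := by
      by_contra hc
      push Not at hc
      have : |B1| < |B2| := by linarith
      nlinarith
    have hB : |B1| ≤ |B2| := by
      by_contra hc
      push Not at hc
      have : |A1| < |A2| := by linarith
      nlinarith
    have hdot : A1 * p2 + B1 * r2 + C1 * q2 = 0 := by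
      have hd := h2.1.2.1
      rcases h2.1.1 with h | h
      · apply mul_left_cancel₀ h
        linear_combination A1 * hd - r2 * hAB - q2 * hAC
      · apply mul_left_cancel₀ h
        linear_combination B1 * hd + p2 * hAB - q2 * hBC
    have hA' : |(A1 : ℝ)| ≤ |(A2 : ℝ)| := by exact_mod_cast hA
    have hB' : |(B1 : ℝ)| ≤ |(B2 : ℝ)| := by exact_mod_cast hB
    have := h2.2 A1 B1 C1 ⟨h1.1.1, hdot, hA'.trans h2.1.2.2.1, hB'.trans h2.1.2.2.2⟩
    constructor <;> linarith
  have hboth : |A1| = |A2| ∧ |B1| = |B2| := by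
    rcases le_total (|A1| + |B1|) (|A2| + |B2|) with h | h
    · exact key h1 h2 hAB hAC hBC h
    · have := key h2 h1 hAB.symm hAC.symm hBC.symm h
      exact ⟨this.1.symm, this.2.symm⟩
  have eA : |(A1 : ℝ)| = |(A2 : ℝ)| := by exact_mod_cast hboth.1
  have eB : |(B1 : ℝ)| = |(B2 : ℝ)| := by exact_mod_cast hboth.2
  have hAB' : (A1 : ℝ) * B2 = A2 * B1 := by exact_mod_cast hAB
  have hAC' : (A1 : ℝ) * C2 = A2 * C1 := by exact_mod_cast hAC
  have hBC' : (B1 : ℝ) * C2 = B2 * C1 := by exact_mod_cast hBC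
  have fin : ∀ F1 F2 : ℝ, (A2 : ℝ) * F1 = A1 * F2 → (B2 : ℝ) * F1 = B1 * F2 → |F1| = |F2| := by
    intro F1 F2 e1 e2
    rcases h2.1.1 with h | h
    · have h' : |(A2 : ℝ)| ≠ 0 := by simpa using h
      apply mul_left_cancel₀ h'
      rw [← abs_mul, e1, abs_mul, eA]
    · have h' : |(B2 : ℝ)| ≠ 0 := by simpa using h
      apply mul_left_cancel₀ h'
      rw [← abs_mul, e2, abs_mul, eB]
  refine ⟨fun x y => fin _ _ ?_ ?_, fun w => fin _ _ ?_ ?_⟩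
  · linear_combination -y * hAB' - hAC'
  · linear_combination x * hAB' - hBC'
  · linear_combination -w * hAB'
  · linear_combination hAB'

lemma exists_red (q : ℕ) (hq : 0 < q) (p r : ℤ) : ∃ (q' : ℕ) (p' r' : ℤ), 0 < q' ∧ q' ≤ q ∧
    Red q' p' r' ∧ (q' : ℤ) * p = q * p' ∧ (q' : ℤ) * r = q * r' := by
  classical
  have hex : ∃ q' : ℕ, 0 < q' ∧ ∃ p' r' : ℤ, (q' : ℤ) * p = q * p' ∧ (q' : ℤ) * r = q * r' :=
    ⟨q, hq, p, r, rfl, rfl⟩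
  obtain ⟨h0, p', r', h1, h2⟩ := Nat.find_spec hex
  refine ⟨Nat.find hex, p', r', h0, Nat.find_min' hex ⟨hq, p, r, rfl, rfl⟩, ?_, h1, h2⟩
  intro q'' p'' r'' h0'' h1'' h2''
  apply Nat.find_min' hex
  have hne : ((Nat.find hex : ℕ) : ℤ) ≠ 0 := by exact_mod_cast h0.ne'
  refine ⟨h0'', p'', r'', ?_, ?_⟩
  · apply mul_left_cancel₀ hne
    linear_combination (q'' : ℤ) * h1 + (q : ℤ) * h1''
  · apply mul_left_cancel₀ hne
    linear_combination (q'' : ℤ) * h2 + (q : ℤ) * h2''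

lemma cross_zero_or_eq {q1 q2 : ℕ} {p1 r1 p2 r2 A1 B1 C1 A2 B2 C2 : ℤ} (hq1 : 0 < q1) (hq2 : 0 < q2)
    (hr1 : Red q1 p1 r1) (hr2 : Red q2 p2 r2)
    (h11 : A1 * p1 + B1 * r1 + C1 * q1 = 0) (h12 : A1 * p2 + B1 * r2 + C1 * q2 = 0)
    (h21 : A2 * p1 + B2 * r1 + C2 * q1 = 0) (h22 : A2 * p2 + B2 * r2 + C2 * q2 = 0) :
    (A1 * B2 = A2 * B1 ∧ A1 * C2 = A2 * C1 ∧ B1 * C2 = B2 * C1) ∨ (q1 = q2 ∧ p1 = p2 ∧ r1 = r2) := by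
  have hq1' : (q1 : ℤ) ≠ 0 := by exact_mod_cast hq1.ne'
  have hq2' : (q2 : ℤ) ≠ 0 := by exact_mod_cast hq2.ne'
  set q0 := A1 * B2 - A2 * B1 with hq0
  set p0 := B1 * C2 - B2 * C1 with hp0
  set r0 := C1 * A2 - C2 * A1 with hr0
  have a1 : (q1 : ℤ) * p0 = p1 * q0 := by rw [hp0, hq0]; linear_combination B1 * h21 - B2 * h11
  have a2 : (q1 : ℤ) * r0 = r1 * q0 := by rw [hr0, hq0]; linear_combination A2 * h11 - A1 * h21
  have b1 : (q2 : ℤ) * p0 = p2 * q0 := by rw [hp0, hq0]; linear_combination B1 * h22 - B2 * h12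
  have b2 : (q2 : ℤ) * r0 = r2 * q0 := by rw [hr0, hq0]; linear_combination A2 * h12 - A1 * h22
  by_cases h : q0 = 0
  · left
    rw [h, mul_zero] at a1 a2
    have c1 : p0 = 0 := (mul_eq_zero.1 a1).resolve_left hq1'
    have c2 : r0 = 0 := (mul_eq_zero.1 a2).resolve_left hq1'
    refine ⟨by linarith, by linarith, by linarith⟩
  · right
    have e1 : (q2 : ℤ) * p1 = q1 * p2 := by
      apply mul_left_cancel₀ h
      linear_combination -(q2 : ℤ) * a1 + (q1 : ℤ) * b1
    have e2 : (q2 : ℤ) * r1 = q1 * r2 := by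
      apply mul_left_cancel₀ h
      linear_combination -(q2 : ℤ) * a2 + (q1 : ℤ) * b2
    have l1 := hr1 q2 p2 r2 hq2 e1 e2
    have l2 := hr2 q1 p1 r1 hq1 e1.symm e2.symm
    have e : q1 = q2 := le_antisymm l1 l2
    subst e
    exact ⟨rfl, mul_left_cancel₀ hq1' e1, mul_left_cancel₀ hq1' e2⟩

/-- powers of two with real exponent -/
noncomputable def E (x : ℝ) : ℝ := (2 : ℝ) ^ x

lemma E_pos (x : ℝ) : 0 < E x := by unfold E; positivity
lemma E_mul (x y : ℝ) : E x * E y = E (x + y) := by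
  unfold E; rw [Real.rpow_add (by norm_num)]
lemma E_le {x y : ℝ} (h : x ≤ y) : E x ≤ E y :=
  Real.rpow_le_rpow_of_exponent_le (by norm_num) h
lemma E_lt {x y : ℝ} (h : x < y) : E x < E y :=
  Real.rpow_lt_rpow_of_exponent_lt (by norm_num) h
lemma E_le_iff {x y : ℝ} : E x ≤ E y ↔ x ≤ y :=
  ⟨fun h => by by_contra hc; exact absurd h (not_le.2 (E_lt (not_le.1 hc))), E_le⟩
lemma E_lt_iff {x y : ℝ} : E x < E y ↔ x < y :=
  ⟨fun h => by by_contra hc; exact absurd h (not_lt.2 (E_le (not_lt.1 hc))), E_lt⟩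
lemma E_zero : E 0 = 1 := by simp [E]
lemma E_one : E 1 = 2 := by simp [E]
lemma E_nat (n : ℕ) : E n = 2 ^ n := by simp [E]
lemma E_neg (x : ℝ) : E (-x) = (E x)⁻¹ := by
  unfold E; rw [Real.rpow_neg (by norm_num)]
lemma E_rpow (x y : ℝ) : (E x) ^ y = E (x * y) := by
  unfold E; rw [← Real.rpow_mul (by norm_num)]
lemma E_sq (x : ℝ) : (E x) ^ 2 = E (2 * x) := by rw [sq, E_mul]; ring_nf
lemma E_add_le {x y z : ℝ} (hx : x ≤ z - 1) (hy : y ≤ z - 1) : E x + E y ≤ E z := by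
  have h1 := E_le hx
  have h2 := E_le hy
  have : E z = 2 * E (z - 1) := by rw [← E_one, E_mul]; ring_nf
  linarith
lemma E_half {x : ℝ} (hx : x ≤ -1) : E x ≤ 1 / 2 := by
  have := E_le hx
  rw [E_neg, E_one] at this
  linarith
lemma E_lt_one {x : ℝ} (hx : x < 0) : E x < 1 := by
  rw [← E_zero]; exact E_lt hx

/-- the data of the problem -/
structure Ctx where
  i : ℝ
  j : ℝ
  D : ℕ
  w : ℕ
  X : ℝ → ℝ
  Y : ℝ → ℝ
  W : ℝ → ℝ
  V : ℕ → ℤ → ℤ → ℤ × ℤ × ℤ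
  hi : 0 < i
  hj : 0 < j
  hij : i + j = 1
  hji : j ≤ i
  hX1 : ∀ s ∈ Icc (0 : ℝ) 1, ∀ t ∈ Icc (0 : ℝ) 1, |X s - X t| ≤ E w * |s - t|
  hX2 : ∀ s ∈ Icc (0 : ℝ) 1, ∀ t ∈ Icc (0 : ℝ) 1, |s - t| ≤ E w * |X s - X t|
  hW1 : ∀ s ∈ Icc (0 : ℝ) 1, ∀ t ∈ Icc (0 : ℝ) 1, |W s - W t| ≤ E w * |s - t|
  hW2 : ∀ s ∈ Icc (0 : ℝ) 1, ∀ t ∈ Icc (0 : ℝ) 1, |s - t| ≤ E w * |W s - W t|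
  hW0 : ∀ s ∈ Icc (0 : ℝ) 1, |W s| ≤ E w
  hY : ∀ s ∈ Icc (0 : ℝ) 1, ∀ t ∈ Icc (0 : ℝ) 1, ∃ ξ ∈ uIcc s t, Y s - Y t = W ξ * (X s - X t)
  hV : ∀ q p r, 0 < q → MDv i j q p r (V q p r).1 (V q p r).2.1 (V q p r).2.2

namespace Ctx

/-- homogeneous zone -/
def Z (S : Ctx) (q : ℕ) (p r : ℤ) (u : ℝ) : Prop :=
  |q * S.X u - p| ≤ E (-S.D) * (q : ℝ) ^ (-S.i) ∧ |q * S.Y u - r| ≤ E (-S.D) * (q : ℝ) ^ (-S.j)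

/-- linear form -/
def F (S : Ctx) (v : ℤ × ℤ × ℤ) (u : ℝ) : ℝ := v.1 * S.X u + v.2.1 * S.Y u + v.2.2

/-- its slope -/
def G (S : Ctx) (v : ℤ × ℤ × ℤ) (u : ℝ) : ℝ := v.1 + v.2.1 * S.W u

/-- reduced rational point at scale `e` -/
def At (S : Ctx) (e : ℕ) (q : ℕ) (p r : ℤ) (u : ℝ) : Prop :=
  E e ≤ q ∧ (q : ℝ) < E (e + 1) ∧ Red q p r ∧ S.Z q p r u

lemma F_sub (S : Ctx) (v : ℤ × ℤ × ℤ) {s t : ℝ} (hs : s ∈ Icc (0 : ℝ) 1) (ht : t ∈ Icc (0 : ℝ) 1) :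
    ∃ ξ ∈ uIcc s t, S.F v s - S.F v t = S.G v ξ * (S.X s - S.X t) := by
  obtain ⟨ξ, h, e⟩ := S.hY s hs t ht
  refine ⟨ξ, h, ?_⟩
  unfold F G
  linear_combination (v.2.1 : ℝ) * e

lemma uIcc01 {s t ξ : ℝ} (hs : s ∈ Icc (0 : ℝ) 1) (ht : t ∈ Icc (0 : ℝ) 1) (h : ξ ∈ uIcc s t) :
    ξ ∈ Icc (0 : ℝ) 1 := (ordConnected_Icc.uIcc_subset hs ht) h

lemma At.qpos {S : Ctx} {e q : ℕ} {p r : ℤ} {u : ℝ} (h : S.At e q p r u) : 0 < q := by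
  have := (E_pos e).trans_le h.1
  exact_mod_cast this

lemma E_rpow_le {x q y : ℝ} (hy : 0 ≤ y) (hq : q ≤ E x) (hq0 : 0 ≤ q) : q ^ y ≤ E (x * y) := by
  rw [← E_rpow]; exact Real.rpow_le_rpow hq0 hq hy

lemma E_rpow_neg_le {x q y : ℝ} (hy : 0 ≤ y) (hq : E x ≤ q) : q ^ (-y) ≤ E (-(x * y)) := by
  have : E x ^ y ≤ q ^ y := Real.rpow_le_rpow (E_pos x).le hq hy
  rw [Real.rpow_neg ((E_pos x).le.trans hq), E_neg, ← E_rpow]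
  exact inv_anti₀ (by have := E_pos x; positivity) this

lemma E_rpow_neg_ge {x q y : ℝ} (hy : 0 ≤ y) (hq : q ≤ E x) (hq0 : 0 < q) : E (-(x * y)) ≤ q ^ (-y) := by
  have : q ^ y ≤ E x ^ y := Real.rpow_le_rpow hq0.le hq hy
  rw [Real.rpow_neg hq0.le, E_neg, ← E_rpow]
  exact inv_anti₀ (by positivity) this

/-- all the basic facts on a point and its vector -/
lemma At.facts {S : Ctx} {e q : ℕ} {p r : ℤ} {u : ℝ} (h : S.At e q p r u) :
    |((S.V q p r).1 : ℝ)| ≤ E (S.i * (e + 1)) ∧ |((S.V q p r).2.1 : ℝ)| ≤ E (S.j * (e + 1)) ∧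
    |S.F (S.V q p r) u| ≤ E (1 - S.D - e) := by
  have hq := h.qpos
  have hq0 : (0 : ℝ) < q := by exact_mod_cast hq
  obtain ⟨h1, h2, h3, hz1, hz2⟩ := h
  obtain ⟨⟨hne, hdot, hA, hB⟩, -⟩ := S.hV q p r hq
  have hi := S.hi
  have hj := S.hj
  refine ⟨?_, ?_, ?_⟩
  · refine hA.trans ?_
    rw [mul_comm]
    exact E_rpow_le hi.le h2.le hq0.le
  · refine hB.trans ?_
    rw [mul_comm]
    exact E_rpow_le hj.le h2.le hq0.le
  · set A := (S.V q p r).1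
    set B := (S.V q p r).2.1
    set C := (S.V q p r).2.2
    have hd : (A : ℝ) * p + B * r + C * q = 0 := by exact_mod_cast hdot
    have key : q * S.F (S.V q p r) u = A * (q * S.X u - p) + B * (q * S.Y u - r) := by
      unfold F
      linear_combination hd
    have b1 : |(A : ℝ) * (q * S.X u - p)| ≤ E (-S.D) := by
      rw [abs_mul]
      calc _ ≤ (q : ℝ) ^ S.i * (E (-S.D) * (q : ℝ) ^ (-S.i)) := by
            apply mul_le_mul hA hz1 (abs_nonneg _) (by positivity)
        _ = _ := by rw [Real.rpow_neg hq0.le]; field_simp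
    have b2 : |(B : ℝ) * (q * S.Y u - r)| ≤ E (-S.D) := by
      rw [abs_mul]
      calc _ ≤ (q : ℝ) ^ S.j * (E (-S.D) * (q : ℝ) ^ (-S.j)) := by
            apply mul_le_mul hB hz2 (abs_nonneg _) (by positivity)
        _ = _ := by rw [Real.rpow_neg hq0.le]; field_simp
    have b3 : q * |S.F (S.V q p r) u| ≤ 2 * E (-S.D) := by
      rw [show (q : ℝ) * |S.F (S.V q p r) u| = |q * S.F (S.V q p r) u| by rw [abs_mul, abs_of_pos hq0], key]
      have := abs_add_le ((A : ℝ) * (q * S.X u - p)) (B * (q * S.Y u - r))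
      linarith
    have b4 : E e * |S.F (S.V q p r) u| ≤ 2 * E (-S.D) :=
      (mul_le_mul_of_nonneg_right h1 (abs_nonneg _)).trans b3
    have e1 : E e * E (1 - S.D - e) = 2 * E (-S.D) := by
      rw [E_mul, ← E_one, E_mul]; ring_nf
    rw [← e1] at b4
    exact le_of_mul_le_mul_left b4 (E_pos e)

lemma vne (S : Ctx) {q : ℕ} {p r : ℤ} (hq : 0 < q) : (S.V q p r).1 ≠ 0 ∨ (S.V q p r).2.1 ≠ 0 :=
  (S.hV q p r hq).1.1

/-- equal up to sign -/
def Par (S : Ctx) (v v' : ℤ × ℤ × ℤ) : Prop :=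
  (∀ u, |S.F v u| = |S.F v' u|) ∧ (∀ u, |S.G v u| = |S.G v' u|)

lemma dot_zero {S : Ctx} {e q1 q2 : ℕ} {p1 r1 p2 r2 : ℤ} {u1 u2 φ : ℝ}
    (h1 : S.At e q1 p1 r1 u1) (h2 : S.At e q2 p2 r2 u2)
    (hF : |S.F (S.V q1 p1 r1) u2| ≤ φ) (hφ : E (e + 1) * φ + 4 * E (-S.D) < 1) :
    (S.V q1 p1 r1).1 * p2 + (S.V q1 p1 r1).2.1 * r2 + (S.V q1 p1 r1).2.2 * q2 = 0 := by
  have hq2 : (0 : ℝ) < q2 := by exact_mod_cast h2.qpos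
  obtain ⟨hA, hB, -⟩ := h1.facts
  obtain ⟨g1, g2, g3, hz1, hz2⟩ := h2
  set A := (S.V q1 p1 r1).1
  set B := (S.V q1 p1 r1).2.1
  set C := (S.V q1 p1 r1).2.2
  have hi := S.hi
  have hj := S.hj
  have hij := S.hij
  have key : ((A * p2 + B * r2 + C * q2 : ℤ) : ℝ) = q2 * S.F (S.V q1 p1 r1) u2
      - A * (q2 * S.X u2 - p2) - B * (q2 * S.Y u2 - r2) := by
    push_cast
    unfold F
    ring
  have b0 : |q2 * S.F (S.V q1 p1 r1) u2| ≤ E (e + 1) * φ := by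
    rw [abs_mul, abs_of_pos hq2]
    exact mul_le_mul g2.le hF (abs_nonneg _) (E_pos _).le
  have b1 : |(A : ℝ) * (q2 * S.X u2 - p2)| ≤ 2 * E (-S.D) := by
    rw [abs_mul]
    calc _ ≤ E (S.i * (e + 1)) * (E (-S.D) * E (-(e * S.i))) := by
          apply mul_le_mul hA (hz1.trans ?_) (abs_nonneg _) (E_pos _).le
          exact mul_le_mul_of_nonneg_left (E_rpow_neg_le hi.le g1) (E_pos _).le
      _ = E (S.i - S.D) := by rw [E_mul, E_mul]; ring_nf
      _ ≤ E (1 + -S.D) := E_le (by linarith)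
      _ = _ := by rw [← E_one, E_mul]
  have b2 : |(B : ℝ) * (q2 * S.Y u2 - r2)| ≤ 2 * E (-S.D) := by
    rw [abs_mul]
    calc _ ≤ E (S.j * (e + 1)) * (E (-S.D) * E (-(e * S.j))) := by
          apply mul_le_mul hB (hz2.trans ?_) (abs_nonneg _) (E_pos _).le
          exact mul_le_mul_of_nonneg_left (E_rpow_neg_le hj.le g1) (E_pos _).le
      _ = E (S.j - S.D) := by rw [E_mul, E_mul]; ring_nf
      _ ≤ E (1 + -S.D) := E_le (by linarith)
      _ = _ := by rw [← E_one, E_mul]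
  have : |((A * p2 + B * r2 + C * q2 : ℤ) : ℝ)| < 1 := by
    rw [key]
    rw [abs_le] at b0 b1 b2
    rw [abs_lt]
    constructor <;> linarith
  have h' : |A * p2 + B * r2 + C * q2| < 1 := by exact_mod_cast this
  exact Int.abs_lt_one_iff.1 h'

lemma regime1 {S : Ctx} {e q1 q2 : ℕ} {p1 r1 p2 r2 : ℤ} {u1 u2 φ : ℝ}
    (h1 : S.At e q1 p1 r1 u1) (h2 : S.At e q2 p2 r2 u2)
    (hF : |S.F (S.V q1 p1 r1) u2| ≤ φ) (hF' : |S.F (S.V q2 p2 r2) u1| ≤ φ)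
    (hφ : E (e + 1) * φ + 4 * E (-S.D) < 1) : S.Par (S.V q1 p1 r1) (S.V q2 p2 r2) := by
  have a1 := dot_zero h1 h2 hF hφ
  have a2 := dot_zero h2 h1 hF' hφ
  have m1 := S.hV q1 p1 r1 h1.qpos
  have m2 := S.hV q2 p2 r2 h2.qpos
  rcases cross_zero_or_eq h1.qpos h2.qpos h1.2.2.1 h2.2.2.1 m1.1.2.1 a1 a2 m2.1.2.1 with
    ⟨c1, c2, c3⟩ | ⟨rfl, rfl, rfl⟩
  · obtain ⟨k1, k2⟩ := parallel_eq m1 m2 c1 c2 c3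
    exact ⟨fun u => k1 _ _, fun u => k2 _⟩
  · exact ⟨fun u => rfl, fun u => rfl⟩

lemma regime2 {S : Ctx} {q1 q2 : ℕ} {p1 r1 p2 r2 : ℤ} {u g b φ α y : ℝ}
    (hq1 : 0 < q1) (hq2 : 0 < q2)
    (hG1 : |S.G (S.V q1 p1 r1) u| ≤ g) (hG2 : |S.G (S.V q2 p2 r2) u| ≤ g)
    (hB1 : |((S.V q1 p1 r1).2.1 : ℝ)| ≤ b) (hB2 : |((S.V q2 p2 r2).2.1 : ℝ)| ≤ b)
    (hF1 : |S.F (S.V q1 p1 r1) u| ≤ φ) (hF2 : |S.F (S.V q2 p2 r2) u| ≤ φ)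
    (hA1 : |((S.V q1 p1 r1).1 : ℝ)| ≤ α) (hA2 : |((S.V q2 p2 r2).1 : ℝ)| ≤ α)
    (hy : 2 * (g * b) ≤ E y) (hx : 2 * (b * φ) ≤ E (-S.D - S.i * y))
    (hx' : 2 * (b * φ) < 1)
    (hr : 2 * (α * φ) ≤ E (-S.D - 1 - S.i * y) + E (-S.D - 1 - S.j * y))
    (hr' : 2 * (α * φ) < 1)
    (hgood : ∀ (q : ℕ) (p r : ℤ), 0 < q → (q : ℝ) ≤ E y → ¬ S.Z q p r u) :
    S.Par (S.V q1 p1 r1) (S.V q2 p2 r2) := by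
  have m1 := S.hV q1 p1 r1 hq1
  have m2 := S.hV q2 p2 r2 hq2
  have hi := S.hi
  have hj := S.hj
  have hij := S.hij
  have hji := S.hji
  suffices hc : (S.V q1 p1 r1).1 * (S.V q2 p2 r2).2.1 = (S.V q2 p2 r2).1 * (S.V q1 p1 r1).2.1 ∧
      (S.V q1 p1 r1).1 * (S.V q2 p2 r2).2.2 = (S.V q2 p2 r2).1 * (S.V q1 p1 r1).2.2 ∧
      (S.V q1 p1 r1).2.1 * (S.V q2 p2 r2).2.2 = (S.V q2 p2 r2).2.1 * (S.V q1 p1 r1).2.2 by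
    obtain ⟨k1, k2⟩ := parallel_eq m1 m2 hc.1 hc.2.1 hc.2.2
    exact ⟨fun u => k1 _ _, fun u => k2 _⟩
  unfold F at hF1 hF2
  unfold G at hG1 hG2
  clear m1 m2
  generalize (S.V q1 p1 r1).1 = A1 at *
  generalize (S.V q1 p1 r1).2.1 = B1 at *
  generalize (S.V q1 p1 r1).2.2 = C1 at *
  generalize (S.V q2 p2 r2).1 = A2 at *
  generalize (S.V q2 p2 r2).2.1 = B2 at *
  generalize (S.V q2 p2 r2).2.2 = C2 at *
  set q0 := A1 * B2 - A2 * B1 with hq0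
  set p0 := B1 * C2 - B2 * C1 with hp0
  set r0 := C1 * A2 - C2 * A1 with hr0
  have two : ∀ {x1 x2 y1 y2 a c : ℝ}, |x1| ≤ a → |x2| ≤ a → |y1| ≤ c → |y2| ≤ c →
      |x2 * y1 - x1 * y2| ≤ 2 * (a * c) := by
    intro x1 x2 y1 y2 a c h1 h2 h3 h4
    have ha := (abs_nonneg _).trans h1
    have e1 : |x2 * y1| ≤ a * c := by
      rw [abs_mul]; exact mul_le_mul h2 h3 (abs_nonneg _) ha
    have e2 : |x1 * y2| ≤ a * c := by
      rw [abs_mul]; exact mul_le_mul h1 h4 (abs_nonneg _) ha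
    rw [abs_le] at *
    constructor <;> linarith
  have bq : |(q0 : ℝ)| ≤ E y := by
    refine le_trans ?_ hy
    have := two hG2 hG1 hB2 hB1
    have e0 : (q0 : ℝ) = (A1 + B1 * S.W u) * B2 - (A2 + B2 * S.W u) * B1 := by
      rw [hq0]; push_cast; ring
    rw [e0]
    exact this
  have bp : |q0 * S.X u - p0| ≤ 2 * (b * φ) := by
    have := two hB1 hB2 hF1 hF2
    convert this using 2
    rw [hq0, hp0]; push_cast; ring
  have br : |q0 * S.Y u - r0| ≤ 2 * (α * φ) := by
    have := two hA2 hA1 hF2 hF1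
    convert this using 2
    rw [hq0, hr0]; push_cast; ring
  have hfin : ∀ (q : ℕ) (p r : ℤ), 0 < q → (q : ℝ) ≤ E y → |q * S.X u - p| ≤ 2 * (b * φ) →
      |q * S.Y u - r| ≤ 2 * (α * φ) → False := by
    intro q p r hq hqy hp hr2
    have hq0 : (0 : ℝ) < q := by exact_mod_cast hq
    have hq1 : (1 : ℝ) ≤ q := by exact_mod_cast hq
    have i1 := E_rpow_neg_ge hi.le hqy hq0
    have j1 := E_rpow_neg_ge hj.le hqy hq0
    have ij : (q : ℝ) ^ (-S.i) ≤ (q : ℝ) ^ (-S.j) :=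
      Real.rpow_le_rpow_of_exponent_le hq1 (by linarith)
    have eD := E_pos (-S.D)
    refine hgood q p r hq hqy ⟨hp.trans (hx.trans ?_), hr2.trans (hr.trans ?_)⟩
    · rw [show -(S.D : ℝ) - S.i * y = -S.D + -(y * S.i) by ring, ← E_mul]
      exact mul_le_mul_of_nonneg_left i1 eD.le
    · have t1 : E (-S.D - 1 - S.i * y) = E (-S.D) * E (-(y * S.i)) / 2 := by
        rw [eq_div_iff (by norm_num), ← E_one, E_mul, E_mul]; ring_nf
      have t2 : E (-S.D - 1 - S.j * y) = E (-S.D) * E (-(y * S.j)) / 2 := by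
        rw [eq_div_iff (by norm_num), ← E_one, E_mul, E_mul]; ring_nf
      rw [t1, t2]
      have := mul_le_mul_of_nonneg_left (i1.trans ij) eD.le
      have := mul_le_mul_of_nonneg_left j1 eD.le
      linarith
  rcases lt_trichotomy q0 0 with h | h | h
  · exfalso
    have hn : ((q0.natAbs : ℕ) : ℝ) = -q0 := by
      rw [← Int.cast_natCast, Int.natCast_natAbs, abs_of_neg h]; push_cast; ring
    refine hfin q0.natAbs (-p0) (-r0) (by omega) ?_ ?_ ?_
    · rw [hn]; exact (neg_le_abs _).trans bq
    · rw [hn, ← abs_neg]; push_cast; convert bp using 2; ring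
    · rw [hn, ← abs_neg]; push_cast; convert br using 2; ring
  · rw [h] at bp br
    simp only [Int.cast_zero, zero_mul, zero_sub, abs_neg] at bp br
    have hp : |(p0 : ℝ)| < 1 := bp.trans_lt hx'
    have hr : |(r0 : ℝ)| < 1 := br.trans_lt hr'
    have hp : p0 = 0 := Int.abs_lt_one_iff.1 (by exact_mod_cast hp)
    have hr : r0 = 0 := Int.abs_lt_one_iff.1 (by exact_mod_cast hr)
    refine ⟨by linarith, by linarith, by linarith⟩
  · exfalso
    have hn : ((q0.natAbs : ℕ) : ℝ) = q0 := by
      rw [← Int.cast_natCast, Int.natCast_natAbs, abs_of_pos h]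
    refine hfin q0.natAbs p0 r0 (by omega) ?_ ?_ ?_
    · rw [hn]; exact (le_abs_self _).trans bq
    · rw [hn]; exact bp
    · rw [hn]; exact br


/-- regular class -/
def Reg (S : Ctx) (n e : ℕ) : Set ℝ :=
  {u | u ∈ Icc (0 : ℝ) 1 ∧ ∃ q p r, S.At e q p r u ∧
    E (S.i ^ 2 / 4 * e - e) * |((S.V q p r).2.1 : ℝ)| ≤ S.G (S.V q p r) u ^ 2 ∧
    E (n - e) ≤ |S.G (S.V q p r) u| ∧ |S.G (S.V q p r) u| < E (n - e + 1)}

/-- special class -/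
def Spec (S : Ctx) (e β : ℕ) : Set ℝ :=
  {u | u ∈ Icc (0 : ℝ) 1 ∧ ∃ q p r, S.At e q p r u ∧
    S.G (S.V q p r) u ^ 2 < E (S.i ^ 2 / 4 * e - e) * |((S.V q p r).2.1 : ℝ)| ∧
    E β ≤ |((S.V q p r).2.1 : ℝ)| ∧ |((S.V q p r).2.1 : ℝ)| < E (β + 1)}

/-- inhomogeneous class -/
def Inh (S : Ctx) (γ δ : ℝ) (e : ℕ) : Set ℝ :=
  {u | u ∈ Icc (0 : ℝ) 1 ∧ ∃ (q : ℕ) (p r : ℤ), E e ≤ q ∧ (q : ℝ) < E (e + 1) ∧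
    |q * S.X u - p - γ| ≤ E (-(2 * S.D)) * (q : ℝ) ^ (-S.i) ∧
    |q * S.Y u - r - δ| ≤ E (-(2 * S.D)) * (q : ℝ) ^ (-S.j)}

/-- interval conditions -/
structure IsJ (S : Ctx) (l : ℕ) (J : Set ℝ) : Prop where
  sub : J ⊆ Icc (0 : ℝ) 1
  oc : OrdConnected J
  diam : ∀ s ∈ J, ∀ t ∈ J, |s - t| ≤ E (-l)
  good : ∀ y : ℝ, S.D + (1 + S.i) * y ≤ l → ∀ u ∈ J, ∀ (q : ℕ) (p r : ℤ), 0 < q → (q : ℝ) ≤ E y →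
    ¬ S.Z q p r u

lemma G_sub {S : Ctx} {l : ℕ} {J : Set ℝ} (hJ : S.IsJ l J) (v : ℤ × ℤ × ℤ) {b s t : ℝ}
    (hb : |(v.2.1 : ℝ)| ≤ E b) (hs : s ∈ J) (ht : t ∈ J) : |S.G v s - S.G v t| ≤ E (b + S.w - l) := by
  have h1 := S.hW1 s (hJ.sub hs) t (hJ.sub ht)
  have h2 := hJ.diam s hs t ht
  have : S.G v s - S.G v t = v.2.1 * (S.W s - S.W t) := by unfold G; ring
  rw [this, abs_mul]
  calc _ ≤ E b * (E S.w * E (-l)) := by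
        apply mul_le_mul hb _ (abs_nonneg _) (E_pos _).le
        exact h1.trans (mul_le_mul_of_nonneg_left h2 (E_pos _).le)
    _ = _ := by rw [E_mul, E_mul]; ring_nf

lemma F_move {S : Ctx} {l : ℕ} {J : Set ℝ} (hJ : S.IsJ l J) (v : ℤ × ℤ × ℤ) {g f s t : ℝ}
    (hg : ∀ ξ ∈ J, |S.G v ξ| ≤ E g) (hs : s ∈ J) (ht : t ∈ J) (hf : |S.F v s| ≤ f) :
    |S.F v t| ≤ f + E (g + S.w - l) := by
  obtain ⟨ξ, hξ, e⟩ := S.F_sub v (hJ.sub ht) (hJ.sub hs)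
  have hξJ : ξ ∈ J := hJ.oc.uIcc_subset ht hs hξ
  have h1 := S.hX1 t (hJ.sub ht) s (hJ.sub hs)
  have h2 := hJ.diam t ht s hs
  have h3 : |S.G v ξ * (S.X t - S.X s)| ≤ E (g + S.w - l) := by
    rw [abs_mul]
    calc _ ≤ E g * (E S.w * E (-l)) := by
          apply mul_le_mul (hg ξ hξJ) _ (abs_nonneg _) (E_pos _).le
          exact h1.trans (mul_le_mul_of_nonneg_left h2 (E_pos _).le)
      _ = _ := by rw [E_mul, E_mul]; ring_nf
  have : S.F v t = S.F v s + S.G v ξ * (S.X t - S.X s) := by linarith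
  rw [this]
  exact (abs_add_le _ _).trans (by linarith)

lemma A_le {S : Ctx} (v : ℤ × ℤ × ℤ) {g b u : ℝ} (hu : u ∈ Icc (0 : ℝ) 1)
    (hg : |S.G v u| ≤ E g) (hb : |(v.2.1 : ℝ)| ≤ E b) : |(v.1 : ℝ)| ≤ E g + E (b + S.w) := by
  have : (v.1 : ℝ) = S.G v u - v.2.1 * S.W u := by unfold G; ring
  rw [this]
  have h2 : |(v.2.1 : ℝ) * S.W u| ≤ E (b + S.w) := by
    rw [abs_mul, ← E_mul]
    exact mul_le_mul hb (S.hW0 u hu) (abs_nonneg _) (E_pos _).le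
  exact (abs_sub _ _).trans (by linarith)

lemma reg_arith {i e n m k c : ℝ} (hi : 0 < i) (hi1 : i < 1) (he0 : 0 ≤ e) (hn0 : 0 ≤ n) (hc : 0 ≤ c)
    (hkdef : k = (1 + i) * e - n) (hmk : m ≤ i ^ 2 / 8 * k) (hk : 2 * c ≤ i * k) :
    0 ≤ k ∧ m ≤ i * k / 8 ∧ i * k ≤ 2 * (i * e) ∧ i * k ≤ k ∧ m ≤ i * e / 4 := by
  have hk0 : 0 ≤ k := by
    by_contra hc
    push Not at hc
    nlinarith
  have hii : i ^ 2 ≤ i := by nlinarith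
  have hmk' : m ≤ i * k / 8 := by nlinarith
  have hk2 : k ≤ 2 * e := by rw [hkdef]; nlinarith
  have hik : i * k ≤ 2 * (i * e) := by nlinarith
  have hikk : i * k ≤ k := by nlinarith
  exact ⟨hk0, hmk', hik, hikk, by linarith⟩

set_option maxHeartbeats 1000000 in
lemma reg_sep {S : Ctx} {n e l m : ℕ} {J : Set ℝ} (hJ : S.IsJ l J) (hD : 10 ≤ S.D) (hDw : S.w ≤ S.D)
    (hl : (l : ℝ) = n + (S.w + 6) - m)
    (hcase : m = 0 ∨ ((m : ℝ) ≤ S.i ^ 2 / 8 * ((1 + S.i) * e - n) ∧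
      2 * ((S.D : ℝ) + S.w + 10) ≤ S.i * ((1 + S.i) * e - n)))
    {u u' : ℝ} (hu : u ∈ S.Reg n e) (huJ : u ∈ J) (hu' : u' ∈ S.Reg n e) (huJ' : u' ∈ J) :
    |u - u'| ≤ E (3 + S.w - S.D - n) := by
  have hi := S.hi
  have hj := S.hj
  have hij := S.hij
  have hji := S.hji
  have hi1 : S.i < 1 := by linarith
  have hDr : (10 : ℝ) ≤ S.D := by exact_mod_cast hD
  have hw0 : (0 : ℝ) ≤ S.w := by positivity
  have hDwr : (S.w : ℝ) ≤ S.D := by exact_mod_cast hDw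
  have he0 : (0 : ℝ) ≤ e := by positivity
  have hn0 : (0 : ℝ) ≤ n := by positivity
  have hii : S.i ^ 2 ≤ S.i := by nlinarith
  have hii0 : 0 ≤ S.i ^ 2 := sq_nonneg _
  have hm : (m : ℝ) ≤ S.i ^ 2 / 4 * e := by
    rcases hcase with h | ⟨h, -⟩
    · rw [h]; push_cast; positivity
    · nlinarith [mul_nonneg hii0 he0, mul_nonneg hii0 hn0]
  obtain ⟨-, q1, p1, r1, h1, hT1, hGl1, hGu1⟩ := hu
  obtain ⟨-, q2, p2, r2, h2, hT2, hGl2, hGu2⟩ := hu'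
  have aux : ∀ {u : ℝ} {q : ℕ} {p r : ℤ}, u ∈ J → S.At e q p r u →
      E (S.i ^ 2 / 4 * e - e) * |((S.V q p r).2.1 : ℝ)| ≤ S.G (S.V q p r) u ^ 2 →
      E (n - e) ≤ |S.G (S.V q p r) u| → |S.G (S.V q p r) u| < E (n - e + 1) →
      (∀ ξ ∈ J, |S.G (S.V q p r) ξ| ≤ E (n - e + 2)) ∧
      (∀ ξ ∈ J, E (n - e - 1) ≤ |S.G (S.V q p r) ξ|) := by
    intro u q p r huJ h hT hGl hGu
    have hB : |((S.V q p r).2.1 : ℝ)| ≤ E (2 * (n - e + 1) - (S.i ^ 2 / 4 * e - e)) := by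
      have h5 : S.G (S.V q p r) u ^ 2 ≤ E (2 * (n - e + 1)) := by
        rw [← E_sq, ← sq_abs]
        exact pow_le_pow_left₀ (abs_nonneg _) hGu.le 2
      have h6 := hT.trans h5
      have h7 : E (2 * (n - e + 1)) = E (S.i ^ 2 / 4 * e - e) *
          E (2 * (n - e + 1) - (S.i ^ 2 / 4 * e - e)) := by rw [E_mul]; ring_nf
      rw [h7] at h6
      exact le_of_mul_le_mul_left h6 (E_pos _)
    have hd : ∀ ξ ∈ J, |S.G (S.V q p r) ξ - S.G (S.V q p r) u| ≤ E (n - e - 1) := by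
      intro ξ hξ
      refine (G_sub hJ _ hB hξ huJ).trans (E_le ?_)
      rw [hl]; linarith
    have t1 : E ((n : ℝ) - e + 1) = 2 * E (n - e) := by rw [← E_one, E_mul]; ring_nf
    have t2 : E ((n : ℝ) - e + 2) = 4 * E (n - e) := by
      rw [show (4 : ℝ) = E 2 by simp [E]; norm_num, E_mul]; ring_nf
    have t3 : E ((n : ℝ) - e) = 2 * E (n - e - 1) := by rw [← E_one, E_mul]; ring_nf
    have t4 := E_pos ((n : ℝ) - e - 1)
    constructor
    · intro ξ hξ
      have := hd ξ hξ
      have h8 := abs_sub_abs_le_abs_sub (S.G (S.V q p r) ξ) (S.G (S.V q p r) u)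
      linarith
    · intro ξ hξ
      have := hd ξ hξ
      have h8 := abs_sub_abs_le_abs_sub (S.G (S.V q p r) u) (S.G (S.V q p r) ξ)
      rw [abs_sub_comm] at h8
      linarith
  obtain ⟨gu1, gl1⟩ := aux huJ h1 hT1 hGl1 hGu1
  obtain ⟨gu2, gl2⟩ := aux huJ' h2 hT2 hGl2 hGu2
  obtain ⟨fA1, fB1, fF1⟩ := h1.facts
  obtain ⟨fA2, fB2, fF2⟩ := h2.facts
  have m1 := F_move hJ _ gu1 huJ huJ' fF1
  have m2 := F_move hJ _ gu2 huJ' huJ fF2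
  have par : S.Par (S.V q1 p1 r1) (S.V q2 p2 r2) := by
    rcases hcase with hm0 | ⟨hmk, hk⟩
    · have hb : E (1 - S.D - e) + E ((n : ℝ) - e + 2 + S.w - l) ≤ E (-3 - e) := by
        apply E_add_le
        · linarith
        · rw [hl, hm0]; push_cast; linarith
      refine regime1 h1 h2 (m1.trans hb) (m2.trans hb) ?_
      rw [E_mul]
      have z1 : E ((e : ℝ) + 1 + (-3 - e)) ≤ 1 / 4 := by
        have : E ((e : ℝ) + 1 + (-3 - e)) = (1 / 4) := by
          rw [show (e : ℝ) + 1 + (-3 - e) = -2 by ring]; simp [E]; norm_num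
        exact this.le
      have z2 : E (-(S.D : ℝ)) ≤ 1 / 8 := by
        have : E (-(3 : ℝ)) = (1 / 8) := by
          simp [E]; norm_num
        rw [← this]; exact E_le (by linarith)
      linarith
    · set k : ℝ := (1 + S.i) * e - n with hkdef
      obtain ⟨hk0, hmk', hik, hikk, hm'⟩ := reg_arith hi hi1 he0 hn0 (by linarith) hkdef hmk hk
      have hkj : (n : ℝ) - e = S.i * e - k := by rw [hkdef]; ring
      have hb : E (1 - S.D - e) + E ((n : ℝ) - e + 2 + S.w - l) ≤ E (m - e) := by
        have : (0 : ℝ) ≤ m := by positivity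
        apply E_add_le
        · linarith
        · rw [hl]; linarith
      have hb' : E (1 - S.D - e) ≤ E (m - e) := by
        have := E_pos ((n : ℝ) - e + 2 + S.w - l)
        linarith
      have tm : ∀ x y : ℝ, 2 * (E x * E y) = E (x + y + 1) := by
        intro x y
        rw [← E_one, E_mul, E_mul]; ring_nf
      have hje : S.j * e = e - S.i * e := by rw [← sub_eq_iff_eq_add'.2 hij.symm]; ring
      have ejk : S.j * k ≥ 0 := by positivity
      have eje : S.j * e ≥ 0 := by positivity
      have hyi : S.i * (e - k + 4) = S.i * e - S.i * k + 4 * S.i := by ring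
      have hyj : S.j * (e - k + 4) = S.j * e - S.j * k + 4 * S.j := by ring
      have eα : 2 * ((E (n - e + 2) + E (S.j * (e + 1) + S.w)) * E (m - e)) =
          E (n - e + 2 + (m - e) + 1) + E (S.j * (e + 1) + S.w + (m - e) + 1) := by
        rw [← tm, ← tm]; ring
      refine regime2 (g := E (n - e + 2)) (b := E (S.j * (e + 1))) (φ := E (m - e))
        (α := E (n - e + 2) + E (S.j * (e + 1) + S.w)) (y := e - k + 4)
        h1.qpos h2.qpos (gu1 u huJ) (gu2 u huJ) fB1 fB2 (fF1.trans hb') (m2.trans hb)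
        (A_le _ (hJ.sub huJ) (gu1 u huJ) fB1) (A_le _ (hJ.sub huJ) (gu2 u huJ) fB2)
        ?_ ?_ ?_ ?_ ?_ ?_
      · rw [tm]; apply E_le; rw [mul_add, hje]; linarith
      · rw [tm, hyi]; apply E_le; rw [mul_add, hje]; linarith
      · rw [tm]; apply E_lt_one; rw [mul_add, hje]; linarith
      · rw [eα, add_comm]
        apply add_le_add
        · apply E_le; rw [hyi, mul_add, hje]; linarith
        · apply E_le; rw [hyj, hje, hkj]; linarith
      · rw [eα]
        refine lt_of_le_of_lt (E_add_le (z := -1) ?_ ?_) (E_lt_one (by norm_num))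
        · rw [hkj]; linarith
        · rw [mul_add, hje]; linarith
      · apply fun h => hJ.good (e - k + 4) h u huJ
        rw [hl]
        have : (1 + S.i) * (e - k + 4) = n - S.i * k + 4 * (1 + S.i) := by rw [hkdef]; ring
        rw [this]; linarith
  obtain ⟨ξ, hξ, hFs⟩ := S.F_sub (S.V q1 p1 r1) (hJ.sub huJ) (hJ.sub huJ')
  have hξJ : ξ ∈ J := hJ.oc.uIcc_subset huJ huJ' hξ
  have hx2 := S.hX2 u (hJ.sub huJ) u' (hJ.sub huJ')
  have hF2 : |S.F (S.V q1 p1 r1) u'| ≤ E (1 - S.D - e) := by rw [par.1]; exact fF2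
  have hdf : |S.G (S.V q1 p1 r1) ξ| * |S.X u - S.X u'| ≤ E (2 - S.D - e) := by
    rw [← abs_mul, ← hFs]
    refine (abs_sub _ _).trans ((add_le_add fF1 hF2).trans (E_add_le ?_ ?_)) <;> linarith
  have h9 : E (n - e - 1) * |S.X u - S.X u'| ≤ E (2 - S.D - e) :=
    (mul_le_mul_of_nonneg_right (gl1 ξ hξJ) (abs_nonneg _)).trans hdf
  have h10 : |S.X u - S.X u'| ≤ E (3 - S.D - n) := by
    have : E (2 - S.D - e) = E (n - e - 1) * E (3 - S.D - n) := by rw [E_mul]; ring_nf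
    rw [this] at h9
    exact le_of_mul_le_mul_left h9 (E_pos _)
  refine hx2.trans ((mul_le_mul_of_nonneg_left h10 (E_pos _).le).trans ?_)
  rw [E_mul]; apply E_le; linarith


lemma spec_arith {i j e b w D : ℝ} (hi : 0 < i) (hj : 0 < j) (hij : i + j = 1) (he0 : 0 ≤ e)
    (hb0 : 0 ≤ b) (hb : b ≤ j * (e + 1)) (hD : 10 ≤ D) (hw : 0 ≤ w) (hDw : w ≤ D)
    (hc : D + w + 20 ≤ i ^ 2 * e) :
    b + 3 + w + i ^ 2 / 4 * e - e ≤ -D - 1 - i * (3 + i ^ 2 / 8 * e + (3 * b - e) / 2) ∧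
    b + 3 + w + i ^ 2 / 4 * e - e < 0 ∧
    D + (1 + i) * (3 + i ^ 2 / 8 * e + (3 * b - e) / 2) ≤ (w + 6) - i ^ 2 / 8 * e + (e + b) / 2 := by
  have hj' : j = 1 - i := by linarith
  subst hj'
  have hi1 : i < 1 := by linarith
  have hie : 0 ≤ i * e := by positivity
  have hiie : 0 ≤ i ^ 2 * e := by positivity
  have hiie' : i ^ 2 * e ≤ i * e := by nlinarith
  have hiiie : i ^ 3 * e ≤ i ^ 2 * e := by nlinarith
  have hb' : b ≤ e - i * e + 1 - i := by linarith
  have hib : i * b ≤ i * e - i ^ 2 * e + i - i ^ 2 := by nlinarith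
  have h2 : 0 ≤ i ^ 2 := by positivity
  have e1 : i * (3 + i ^ 2 / 8 * e + (3 * b - e) / 2) = 3 * i + i ^ 3 * e / 8 + 3 * (i * b) / 2 - i * e / 2 := by
    ring
  have e2 : (1 + i) * (3 + i ^ 2 / 8 * e + (3 * b - e) / 2) = 3 + i ^ 2 / 8 * e + (3 * b - e) / 2 +
    (3 * i + i ^ 3 * e / 8 + 3 * (i * b) / 2 - i * e / 2) := by
    ring
  rw [e1, e2]
  refine ⟨?_, ?_, ?_⟩
  · linarith
  · linarith
  · linarith

set_option maxHeartbeats 1000000 in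
lemma spec_par {S : Ctx} {e β l : ℕ} {J : Set ℝ} (hJ : S.IsJ l J) (hD : 10 ≤ S.D) (hDw : S.w ≤ S.D)
    (hl : (S.w + 6) - S.i ^ 2 / 8 * e + (e + β) / 2 ≤ (l : ℝ))
    (hcase : (S.w + 6) + S.i ^ 2 / 8 * e + (e + β) / 2 ≤ (l : ℝ) ∨ (S.D : ℝ) + S.w + 20 ≤ S.i ^ 2 * e)
    {u u' : ℝ} (huJ : u ∈ J) (huJ' : u' ∈ J)
    {q1 q2 : ℕ} {p1 r1 p2 r2 : ℤ} (h1 : S.At e q1 p1 r1 u) (h2 : S.At e q2 p2 r2 u')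
    (hG1 : S.G (S.V q1 p1 r1) u ^ 2 < E (S.i ^ 2 / 4 * e - e) * |((S.V q1 p1 r1).2.1 : ℝ)|)
    (hB1 : E β ≤ |((S.V q1 p1 r1).2.1 : ℝ)|) (hB1' : |((S.V q1 p1 r1).2.1 : ℝ)| < E (β + 1))
    (hG2 : S.G (S.V q2 p2 r2) u' ^ 2 < E (S.i ^ 2 / 4 * e - e) * |((S.V q2 p2 r2).2.1 : ℝ)|)
    (hB2' : |((S.V q2 p2 r2).2.1 : ℝ)| < E (β + 1)) :
    S.Par (S.V q1 p1 r1) (S.V q2 p2 r2) := by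
  have hi := S.hi
  have hj := S.hj
  have hij := S.hij
  have hi1 : S.i < 1 := by linarith
  have hDr : (10 : ℝ) ≤ S.D := by exact_mod_cast hD
  have hw0 : (0 : ℝ) ≤ S.w := by positivity
  have hDwr : (S.w : ℝ) ≤ S.D := by exact_mod_cast hDw
  have he0 : (0 : ℝ) ≤ e := by positivity
  have hb0 : (0 : ℝ) ≤ β := by positivity
  have hii1 : S.i ^ 2 ≤ 1 := by nlinarith
  have hii0 : 0 ≤ S.i ^ 2 * e := by positivity
  have hie : S.i ^ 2 * e ≤ e := by nlinarith
  have aux : ∀ {u : ℝ} {q : ℕ} {p r : ℤ}, u ∈ J → S.At e q p r u →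
      S.G (S.V q p r) u ^ 2 < E (S.i ^ 2 / 4 * e - e) * |((S.V q p r).2.1 : ℝ)| →
      |((S.V q p r).2.1 : ℝ)| < E (β + 1) →
      (∀ ξ ∈ J, |S.G (S.V q p r) ξ| ≤ E (1 + S.i ^ 2 / 8 * e + (β - e) / 2)) := by
    intro u q p r huJ h hG hB ξ hξ
    set x : ℝ := S.i ^ 2 / 8 * e + (β - e) / 2 with hx
    have h3 : |S.G (S.V q p r) u| ≤ 3 / 2 * E x := by
      apply abs_le_of_sq_le_sq _ (by have := E_pos x; positivity)
      have : E (S.i ^ 2 / 4 * e - e) * |((S.V q p r).2.1 : ℝ)| ≤ 2 * E x ^ 2 := by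
        calc _ ≤ E (S.i ^ 2 / 4 * e - e) * E (β + 1) := mul_le_mul_of_nonneg_left hB.le (E_pos _).le
          _ = 2 * E x ^ 2 := by rw [E_sq, ← E_one, E_mul, E_mul, E_one, hx]; ring_nf
      nlinarith [sq_nonneg (E x)]
    have h4 := G_sub hJ _ hB.le hξ huJ
    have h5 : E ((β : ℝ) + 1 + S.w - l) ≤ 1 / 2 * E x := by
      have : 1 / 2 * E x = E (x - 1) := by
        rw [show (1 / 2 : ℝ) = E (-1) by rw [E_neg, E_one]; norm_num, E_mul]; ring_nf
      rw [this]; apply E_le; rw [hx]; linarith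
    have h6 := abs_sub_abs_le_abs_sub (S.G (S.V q p r) ξ) (S.G (S.V q p r) u)
    have h7 : E (1 + S.i ^ 2 / 8 * e + (β - e) / 2) = 2 * E x := by
      rw [← E_one, E_mul, hx, E_one]; ring_nf
    rw [h7]; linarith
  have gu1 := aux huJ h1 hG1 hB1'
  have gu2 := aux huJ' h2 hG2 hB2'
  obtain ⟨fA1, fB1, fF1⟩ := h1.facts
  obtain ⟨fA2, fB2, fF2⟩ := h2.facts
  have m1 := F_move hJ _ gu1 huJ huJ' fF1
  have m2 := F_move hJ _ gu2 huJ' huJ fF2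
  have hbj : (β : ℝ) ≤ S.j * (e + 1) := E_le_iff.1 (hB1.trans fB1)
  rcases hcase with hc | hc
  · have hb : E (1 - S.D - e) + E (1 + S.i ^ 2 / 8 * e + (β - e) / 2 + S.w - l) ≤ E (-3 - e) := by
      apply E_add_le <;> linarith
    refine regime1 h1 h2 (m1.trans hb) (m2.trans hb) ?_
    rw [E_mul]
    have z1 : E ((e : ℝ) + 1 + (-3 - e)) ≤ 1 / 4 := by
      have : E ((e : ℝ) + 1 + (-3 - e)) = (1 / 4) := by
        rw [show (e : ℝ) + 1 + (-3 - e) = -2 by ring]; simp [E]; norm_num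
      exact this.le
    have z2 : E (-(S.D : ℝ)) ≤ 1 / 8 := by
      have : E (-(3 : ℝ)) = (1 / 8) := by
        simp [E]; norm_num
      rw [← this]; exact E_le (by linarith)
    linarith
  · obtain ⟨a1, a2, a3⟩ := spec_arith hi hj hij he0 hb0 hbj hDr hw0 hDwr hc
    have hb : E (1 - S.D - e) + E (1 + S.i ^ 2 / 8 * e + (β - e) / 2 + S.w - l) ≤
        E (S.i ^ 2 / 4 * e - e) := by
      apply E_add_le <;> linarith
    have hb' : E (1 - S.D - e) ≤ E (S.i ^ 2 / 4 * e - e) := by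
      have := E_pos (1 + S.i ^ 2 / 8 * e + (β - e) / 2 + S.w - l)
      linarith
    have hA : E (1 + S.i ^ 2 / 8 * e + (β - e) / 2) + E ((β : ℝ) + 1 + S.w) ≤ E (β + 2 + S.w) := by
      apply E_add_le <;> linarith
    have tm : ∀ x y : ℝ, 2 * (E x * E y) = E (x + y + 1) := by
      intro x y
      rw [← E_one, E_mul, E_mul]; ring_nf
    refine regime2 (g := E (1 + S.i ^ 2 / 8 * e + (β - e) / 2)) (b := E (β + 1))
      (φ := E (S.i ^ 2 / 4 * e - e))
      (α := E (β + 2 + S.w)) (y := 3 + S.i ^ 2 / 8 * e + (3 * β - e) / 2)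
      h1.qpos h2.qpos (gu1 u huJ) (gu2 u huJ) hB1'.le hB2'.le (fF1.trans hb') (m2.trans hb)
      ((A_le _ (hJ.sub huJ) (gu1 u huJ) hB1'.le).trans hA)
      ((A_le _ (hJ.sub huJ) (gu2 u huJ) hB2'.le).trans hA)
      ?_ ?_ ?_ ?_ ?_ ?_
    · rw [tm]; apply E_le; linarith
    · rw [tm]; apply E_le; linarith
    · rw [tm]; apply E_lt_one; linarith
    · rw [tm]
      have := E_pos (-S.D - 1 - S.j * (3 + S.i ^ 2 / 8 * e + (3 * β - e) / 2))
      refine le_trans (E_le ?_) (le_add_of_nonneg_right this.le)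
      linarith
    · rw [tm]; apply E_lt_one; linarith
    · apply fun h => hJ.good _ h u huJ
      linarith

lemma spec_sep {S : Ctx} {e β l N : ℕ} {J : Set ℝ} (hJ : S.IsJ l J) (hD : 10 ≤ S.D) (hDw : S.w ≤ S.D)
    (hl : (S.w + 6) - S.i ^ 2 / 8 * e + (e + β) / 2 ≤ (l : ℝ))
    (hcase : (S.w + 6) + S.i ^ 2 / 8 * e + (e + β) / 2 ≤ (l : ℝ) ∨ (S.D : ℝ) + S.w + 20 ≤ S.i ^ 2 * e)
    (hN : 2 * (N : ℝ) ≤ S.D + e + β - 4 - 2 * S.w)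
    {u1 u2 u3 u4 : ℝ} (h1 : u1 ∈ S.Spec e β ∩ J) (h2 : u2 ∈ S.Spec e β ∩ J)
    (h3 : u3 ∈ S.Spec e β ∩ J) (h4 : u4 ∈ S.Spec e β ∩ J)
    (h12 : u1 + E (-N) ≤ u2) (h23 : u2 + E (-N) ≤ u3) (h34 : u3 + E (-N) ≤ u4) : False := by
  obtain ⟨⟨-, q, p, r, hat, hG, hB, hB'⟩, hJ1⟩ := h1
  have hsmall : ∀ u ∈ S.Spec e β ∩ J, |S.F (S.V q p r) u| ≤ E (1 - S.D - e) := by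
    rintro u ⟨⟨-, q', p', r', hat', hG', hB1', hB2'⟩, hJu⟩
    have := spec_par hJ hD hDw hl hcase hJ1 hJu hat hat' hG hB hB' hG' hB2'
    rw [this.1]
    exact hat'.facts.2.2
  have s1 : |S.F (S.V q p r) u1| ≤ E (1 - S.D - e) := hat.facts.2.2
  have s2 := hsmall u2 h2
  have s3 := hsmall u3 h3
  have s4 := hsmall u4 h4
  have hGs : ∀ s t : ℝ, s ∈ J → t ∈ J → s + E (-N) ≤ t → |S.F (S.V q p r) s| ≤ E (1 - S.D - e) →
      |S.F (S.V q p r) t| ≤ E (1 - S.D - e) → ∃ ξ ∈ Icc s t,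
      |S.G (S.V q p r) ξ| ≤ E (2 + S.w - S.D - e + N) := by
    intro s t hs ht hst hFs hFt
    have hpos := E_pos (-(N : ℝ))
    obtain ⟨ξ, hξ, hF⟩ := S.F_sub (S.V q p r) (hJ.sub hs) (hJ.sub ht)
    rw [uIcc_of_le (by linarith)] at hξ
    refine ⟨ξ, hξ, ?_⟩
    have hx2 := S.hX2 s (hJ.sub hs) t (hJ.sub ht)
    have hdf : |S.G (S.V q p r) ξ| * |S.X s - S.X t| ≤ E (2 - S.D - e) := by
      rw [← abs_mul, ← hF]
      refine (abs_sub _ _).trans ((add_le_add hFs hFt).trans (E_add_le ?_ ?_)) <;> linarith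
    have hst' : E (-N) ≤ |s - t| := by
      rw [abs_sub_comm]; exact le_trans (by linarith) (le_abs_self _)
    have h5 : E (-(N : ℝ)) ≤ E S.w * |S.X s - S.X t| := hst'.trans hx2
    have h6 : E (-(N : ℝ)) * |S.G (S.V q p r) ξ| ≤ E S.w * E (2 - S.D - e) := by
      calc _ ≤ E S.w * |S.X s - S.X t| * |S.G (S.V q p r) ξ| :=
            mul_le_mul_of_nonneg_right h5 (abs_nonneg _)
        _ = E S.w * (|S.G (S.V q p r) ξ| * |S.X s - S.X t|) := by ring
        _ ≤ _ := mul_le_mul_of_nonneg_left hdf (E_pos _).le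
    have h7 : E S.w * E (2 - S.D - e) = E (-(N : ℝ)) * E (2 + S.w - S.D - e + N) := by
      rw [E_mul, E_mul]; ring_nf
    rw [h7] at h6
    exact le_of_mul_le_mul_left h6 hpos
  obtain ⟨ξ, hξ, g1⟩ := hGs u1 u2 hJ1 h2.2 h12 s1 s2
  obtain ⟨η, hη, g2⟩ := hGs u3 u4 h3.2 h4.2 h34 s3 s4
  have hξJ : ξ ∈ J := hJ.oc.out hJ1 h2.2 hξ
  have hηJ : η ∈ J := hJ.oc.out h3.2 h4.2 hη
  have hw2 := S.hW2 ξ (hJ.sub hξJ) η (hJ.sub hηJ)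
  have hd : E (-N) ≤ |ξ - η| := by
    rw [abs_sub_comm]; refine le_trans ?_ (le_abs_self _); linarith [hξ.2, hη.1]
  have hGd : S.G (S.V q p r) ξ - S.G (S.V q p r) η = (S.V q p r).2.1 * (S.W ξ - S.W η) := by
    unfold G; ring
  have hGd' : |((S.V q p r).2.1 : ℝ)| * |S.W ξ - S.W η| ≤ E (3 + S.w - S.D - e + N) := by
    rw [← abs_mul, ← hGd]
    refine (abs_sub _ _).trans ((add_le_add g1 g2).trans (E_add_le ?_ ?_)) <;> linarith
  have h8 : E β * E (-N) ≤ E S.w * E (3 + S.w - S.D - e + N) := by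
    calc _ ≤ |((S.V q p r).2.1 : ℝ)| * (E S.w * |S.W ξ - S.W η|) :=
          mul_le_mul hB (hd.trans hw2) (E_pos _).le (abs_nonneg _)
      _ = E S.w * (|((S.V q p r).2.1 : ℝ)| * |S.W ξ - S.W η|) := by ring
      _ ≤ _ := mul_le_mul_of_nonneg_left hGd' (E_pos _).le
  rw [E_mul, E_mul, E_le_iff] at h8
  linarith

lemma inh_aux {S : Ctx} {γ δ : ℝ} {e l : ℕ} {J : Set ℝ} (hJ : S.IsJ l J) (hD : 10 ≤ S.D)
    (hl : S.D + 2 * S.w + 3 + (1 + S.i) * e ≤ (l : ℝ))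
    {u u' : ℝ} (hu : u ∈ J) (hu' : u' ∈ J) {q q' : ℕ} {p r p' r' : ℤ}
    (hq1 : E e ≤ q) (hq2 : (q : ℝ) < E (e + 1))
    (hX : |q * S.X u - p - γ| ≤ E (-(2 * S.D)) * (q : ℝ) ^ (-S.i))
    (hY : |q * S.Y u - r - δ| ≤ E (-(2 * S.D)) * (q : ℝ) ^ (-S.j))
    (hq1' : E e ≤ q') (hq2' : (q' : ℝ) < E (e + 1))
    (hX' : |q' * S.X u' - p' - γ| ≤ E (-(2 * S.D)) * (q' : ℝ) ^ (-S.i))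
    (hY' : |q' * S.Y u' - r' - δ| ≤ E (-(2 * S.D)) * (q' : ℝ) ^ (-S.j)) (hle : q' ≤ q) :
    q = q' ∧ p = p' ∧ r = r' := by
  have hi := S.hi
  have hj := S.hj
  have hij := S.hij
  have hji := S.hji
  have hDr : (10 : ℝ) ≤ S.D := by exact_mod_cast hD
  have hw0 : (0 : ℝ) ≤ S.w := by positivity
  have he0 : (0 : ℝ) ≤ e := by positivity
  have hje : S.j * e ≤ S.i * e := by nlinarith
  have t : ∀ {q : ℕ} {y : ℝ}, 0 ≤ y → E e ≤ q → E (-(2 * S.D)) * (q : ℝ) ^ (-y) ≤ E (-(2 * S.D) - y * e) := by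
    intro q y hy hq
    have := mul_le_mul_of_nonneg_left (E_rpow_neg_le hy hq) (E_pos (-(2 * S.D))).le
    rw [E_mul] at this
    refine this.trans (E_le ?_); linarith
  have bX := hX.trans (t hi.le hq1)
  have bY := hY.trans (t hj.le hq1)
  have bX' := hX'.trans (t hi.le hq1')
  have bY' := hY'.trans (t hj.le hq1')
  have hdX : |S.X u - S.X u'| ≤ E (S.w - l) := by
    refine (S.hX1 u (hJ.sub hu) u' (hJ.sub hu')).trans ?_
    rw [show (S.w : ℝ) - l = S.w + -l by ring, ← E_mul]
    exact mul_le_mul_of_nonneg_left (hJ.diam u hu u' hu') (E_pos _).le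
  have hdY : |S.Y u - S.Y u'| ≤ E (2 * S.w - l) := by
    obtain ⟨ξ, hξ, h⟩ := S.hY u (hJ.sub hu) u' (hJ.sub hu')
    rw [h, abs_mul, show (2 * (S.w : ℝ) - l) = S.w + (S.w - l) by ring, ← E_mul]
    exact mul_le_mul (S.hW0 ξ (uIcc01 (hJ.sub hu) (hJ.sub hu') hξ)) hdX (abs_nonneg _) (E_pos _).le
  have hqX : |q' * (S.X u - S.X u')| ≤ E (-S.D - 2 - S.i * e) := by
    rw [abs_mul, abs_of_nonneg (by positivity)]
    refine (mul_le_mul hq2'.le hdX (abs_nonneg _) (E_pos _).le).trans ?_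
    rw [E_mul]; apply E_le; linarith
  have hqY : |q' * (S.Y u - S.Y u')| ≤ E (-S.D - 2 - S.i * e) := by
    rw [abs_mul, abs_of_nonneg (by positivity)]
    refine (mul_le_mul hq2'.le hdY (abs_nonneg _) (E_pos _).le).trans ?_
    rw [E_mul]; apply E_le; linarith
  have three : ∀ {a b c A : ℝ}, |a| ≤ E (-(2 * S.D) - A) → |b| ≤ E (-(2 * S.D) - A) →
      |c| ≤ E (-S.D - 2 - A) → |a - b - c| ≤ E (-S.D - A) := by
    intro a b c A h1 h2 h3
    have h4 : E (-(2 * S.D) - A) + E (-(2 * S.D) - A) ≤ E (-S.D - 1 - A) := by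
      apply E_add_le <;> linarith
    have h5 : E (-S.D - 1 - A) + E (-S.D - 2 - A) ≤ E (-S.D - A) := by
      apply E_add_le <;> linarith
    rw [abs_le] at *
    constructor <;> linarith
  obtain ⟨d, rfl⟩ := Nat.exists_eq_add_of_le hle
  have dX : |d * S.X u - ((p - p' : ℤ) : ℝ)| ≤ E (-S.D - S.i * e) := by
    have := three bX bX' hqX
    convert this using 2
    push_cast; ring
  have dY : |d * S.Y u - ((r - r' : ℤ) : ℝ)| ≤ E (-S.D - S.j * e) := by
    have := three bY bY' 
      (hqY.trans (E_le (by linarith)))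
    convert this using 2
    push_cast; ring
  rcases Nat.eq_zero_or_pos d with hd | hd
  · subst hd
    have z : ∀ {m : ℤ} {x A : ℝ}, 0 ≤ A → |((0 : ℕ) : ℝ) * x - (m : ℝ)| ≤ E (-S.D - A) → m = 0 := by
      intro m x A hA h
      rw [Nat.cast_zero, zero_mul, zero_sub, abs_neg] at h
      have h1 : |(m : ℝ)| < 1 := h.trans_lt (E_lt_one (by linarith))
      exact Int.abs_lt_one_iff.1 (by exact_mod_cast h1)
    have z1 := z (by positivity) dX
    have z2 := z (by positivity) dY
    exact ⟨by omega, by omega, by omega⟩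
  · exfalso
    have hd0 : (0 : ℝ) < d := by exact_mod_cast hd
    have hde : (d : ℝ) ≤ E e := by
      have : E ((e : ℝ) + 1) = 2 * E e := by rw [← E_one, E_mul]; ring_nf
      push_cast at hq2
      linarith
    refine hJ.good e (by linarith) u hu d (p - p') (r - r') hd hde ⟨dX.trans ?_, dY.trans ?_⟩
    · rw [show -(S.D : ℝ) - S.i * e = -S.D + -(e * S.i) by ring, ← E_mul]
      exact mul_le_mul_of_nonneg_left (E_rpow_neg_ge hi.le hde hd0) (E_pos _).le
    · rw [show -(S.D : ℝ) - S.j * e = -S.D + -(e * S.j) by ring, ← E_mul]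
      exact mul_le_mul_of_nonneg_left (E_rpow_neg_ge hj.le hde hd0) (E_pos _).le

lemma inh_sep {S : Ctx} {γ δ : ℝ} {e l : ℕ} {J : Set ℝ} (hJ : S.IsJ l J) (hD : 10 ≤ S.D)
    (hl : S.D + 2 * S.w + 3 + (1 + S.i) * e ≤ (l : ℝ))
    {u u' : ℝ} (hu : u ∈ S.Inh γ δ e) (huJ : u ∈ J) (hu' : u' ∈ S.Inh γ δ e) (huJ' : u' ∈ J) :
    |u - u'| ≤ E (-(2 * S.D - S.w - 1 + (1 + S.i) * e)) := by
  obtain ⟨h0, q, p, r, hq1, hq2, hX, hY⟩ := hu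
  obtain ⟨h0', q', p', r', hq1', hq2', hX', hY'⟩ := hu'
  have heq : q = q' ∧ p = p' ∧ r = r' := by
    rcases le_total q' q with h | h
    · exact inh_aux hJ hD hl huJ huJ' hq1 hq2 hX hY hq1' hq2' hX' hY' h
    · obtain ⟨a, b, c⟩ := inh_aux hJ hD hl huJ' huJ hq1' hq2' hX' hY' hq1 hq2 hX hY h
      exact ⟨a.symm, b.symm, c.symm⟩
  obtain ⟨rfl, rfl, rfl⟩ := heq
  have hq0 : (0 : ℝ) < q := (E_pos e).trans_le hq1
  have t : E (-(2 * S.D)) * (q : ℝ) ^ (-S.i) ≤ E (-(2 * S.D) - S.i * e) := by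
    have := mul_le_mul_of_nonneg_left (E_rpow_neg_le S.hi.le hq1) (E_pos (-(2 * S.D))).le
    rw [E_mul] at this
    refine this.trans (E_le ?_); linarith
  have h1 : |q * (S.X u - S.X u')| ≤ E (1 - 2 * S.D - S.i * e) := by
    rw [show (q : ℝ) * (S.X u - S.X u') = (q * S.X u - p - γ) - (q * S.X u' - p - γ) by ring]
    refine (abs_sub _ _).trans ((add_le_add (hX.trans t) (hX'.trans t)).trans (E_add_le ?_ ?_)) <;> linarith
  rw [abs_mul, abs_of_pos hq0] at h1
  have h2 : E e * |S.X u - S.X u'| ≤ E e * E (1 - 2 * S.D - S.i * e - e) := by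
    refine (mul_le_mul_of_nonneg_right hq1 (abs_nonneg _)).trans (h1.trans ?_)
    rw [E_mul]; apply E_le; linarith
  have h3 := le_of_mul_le_mul_left h2 (E_pos e)
  refine (S.hX2 u h0 u' h0').trans ((mul_le_mul_of_nonneg_left h3 (E_pos _).le).trans ?_)
  rw [E_mul]; apply E_le; linarith


/-- `n` for the regular class at level `N` -/
def rn (S : Ctx) (N : ℕ) : ℕ := N + S.w + 3 - S.D

/-- the parameter `k` -/
def kk (S : Ctx) (N e : ℕ) : ℝ := (1 + S.i) * e - S.rn N

open Classical in
/-- the shift `m` -/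
noncomputable def rm (S : Ctx) (N e : ℕ) : ℕ :=
  if 2 * ((S.D : ℝ) + S.w + 10) ≤ S.i * S.kk N e then ⌊S.i ^ 2 / 8 * S.kk N e⌋₊ else 0

/-- the exponent of the special class -/
def sb (S : Ctx) (t N e : ℕ) : ℕ := 2 * N + t + 4 + 2 * S.w - S.D - e

open Classical in
/-- the level of the special class -/
noncomputable def sl (S : Ctx) (t N e : ℕ) : ℕ :=
  if (S.D : ℝ) + S.w + 20 ≤ S.i ^ 2 * e then
    ⌈(S.w + 6) - S.i ^ 2 / 8 * e + ((e : ℝ) + S.sb t N e) / 2⌉₊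
  else ⌈(S.w + 6) + S.i ^ 2 / 8 * e + ((e : ℝ) + S.sb t N e) / 2⌉₊

open Classical in
/-- index set, regular -/
noncomputable def K0 (S : Ctx) (N : ℕ) : Finset ℕ :=
  (Finset.range (2 * S.rn N + 2)).filter (fun e => S.D ≤ N + S.w + 3 ∧ -((S.w : ℝ) + 2) ≤ S.kk N e)

/-- index set, special -/
def K1 (S : Ctx) (t N : ℕ) : Finset ℕ :=
  (Finset.range (2 * N + t + 5 + 2 * S.w)).filter (fun e => e + S.D ≤ 2 * N + t + 4 + 2 * S.w)

open Classical in
/-- index set, inhomogeneous -/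
noncomputable def K3 (S : Ctx) (N : ℕ) : Finset ℕ :=
  (Finset.range (N + 1)).filter (fun e => N = ⌊2 * (S.D : ℝ) - S.w - 1 + (1 + S.i) * e⌋₊)

/-- all indices -/
noncomputable def K (S : Ctx) (N : ℕ) : Finset ((_ : Fin 4) × ℕ) :=
  Finset.univ.sigma (fun t => ![S.K0 N, S.K1 0 N, S.K1 1 N, S.K3 N] t)

/-- all sets -/
noncomputable def BB (S : Ctx) (γ δ : ℝ) (N : ℕ) (κ : (_ : Fin 4) × ℕ) : Set ℝ :=
  ![S.Reg (S.rn N) κ.2, S.Spec κ.2 (S.sb 0 N κ.2), S.Spec κ.2 (S.sb 1 N κ.2), S.Inh γ δ κ.2] κ.1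

/-- all levels -/
noncomputable def ll (S : Ctx) (N : ℕ) (κ : (_ : Fin 4) × ℕ) : ℕ :=
  ![S.rn N + (S.w + 6) - S.rm N κ.2, S.sl 0 N κ.2, S.sl 1 N κ.2,
    ⌈S.D + 2 * (S.w : ℝ) + 3 + (1 + S.i) * κ.2⌉₊] κ.1

lemma K_cases {S : Ctx} {N : ℕ} {P : (_ : Fin 4) × ℕ → Prop} (h0 : ∀ e ∈ S.K0 N, P ⟨0, e⟩)
    (h1 : ∀ e ∈ S.K1 0 N, P ⟨1, e⟩) (h2 : ∀ e ∈ S.K1 1 N, P ⟨2, e⟩) (h3 : ∀ e ∈ S.K3 N, P ⟨3, e⟩) :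
    ∀ κ ∈ S.K N, P κ := by
  rintro ⟨t, e⟩ hκ
  simp only [K, Finset.mem_sigma, Finset.mem_univ, true_and] at hκ
  fin_cases t
  · exact h0 e hκ
  · exact h1 e hκ
  · exact h2 e hκ
  · exact h3 e hκ

lemma i_lt_one (S : Ctx) : S.i < 1 := by
  have := S.hj
  have := S.hij
  linarith

lemma rm_bounds {S : Ctx} {N e : ℕ} (he : e ∈ S.K0 N) (hD : 100 * (S.w + 1) ≤ S.D) :
    (S.rn N : ℝ) = N + S.w + 3 - S.D ∧ S.rm N e ≤ S.rn N + (S.w + 6) ∧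
    (S.rm N e = 0 ∨ ((S.rm N e : ℝ) ≤ S.i ^ 2 / 8 * S.kk N e ∧
      2 * ((S.D : ℝ) + S.w + 10) ≤ S.i * S.kk N e)) ∧
    (S.D : ℝ) / 4 - 10 * (S.w + 2) + S.i ^ 2 / 8 * S.kk N e ≤ S.D - 2 * S.w - 10 + S.rm N e := by
  have hi := S.hi
  have hi1 := S.i_lt_one
  simp only [K0, Finset.mem_filter, Finset.mem_range] at he
  obtain ⟨h1, h2, h3⟩ := he
  have hDr : 100 * ((S.w : ℝ) + 1) ≤ S.D := by exact_mod_cast hD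
  have hw0 : (0 : ℝ) ≤ S.w := by positivity
  have h1r : (e : ℝ) + 1 ≤ 2 * S.rn N + 2 := by exact_mod_cast h1
  have he0 : (0 : ℝ) ≤ e := by positivity
  have hn : (S.rn N : ℝ) = N + S.w + 3 - S.D := by
    unfold rn; rw [Nat.cast_sub h2]; push_cast; ring
  have hk : S.kk N e ≤ 3 * S.rn N + 2 := by unfold kk; nlinarith
  have hn0 : (0 : ℝ) ≤ S.rn N := by positivity
  refine ⟨hn, ?_, ?_, ?_⟩
  · unfold rm
    split_ifs with hc
    · apply Nat.floor_le_of_le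
      push_cast
      have hk0 : 0 ≤ S.kk N e := by
        by_contra hcc
        push Not at hcc
        nlinarith
      have : S.i ^ 2 ≤ 1 := by nlinarith
      nlinarith
    · omega
  · unfold rm
    split_ifs with hc
    · right
      refine ⟨Nat.floor_le ?_, hc⟩
      have hk0 : 0 ≤ S.kk N e := by
        by_contra hcc
        push Not at hcc
        nlinarith
      positivity
    · left; rfl
  · unfold rm
    split_ifs with hc
    · have := Nat.lt_floor_add_one (S.i ^ 2 / 8 * S.kk N e)
      linarith
    · push Not at hc
      push_cast
      have : S.i ^ 2 / 8 * S.kk N e ≤ ((S.D : ℝ) + S.w + 10) / 4 := by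
        have : S.i * (S.i * S.kk N e) ≤ S.i * (2 * ((S.D : ℝ) + S.w + 10)) :=
          mul_le_mul_of_nonneg_left hc.le hi.le
        nlinarith
      linarith

lemma sl_bounds {S : Ctx} {t N e : ℕ} (ht : t ≤ 1) (he : e ∈ S.K1 t N) (hD : 100 * (S.w + 1) ≤ S.D) :
    2 * (N : ℝ) + t = S.D + e + S.sb t N e - 4 - 2 * S.w ∧
    (S.w + 6) - S.i ^ 2 / 8 * e + ((e : ℝ) + S.sb t N e) / 2 ≤ S.sl t N e ∧
    ((S.w + 6) + S.i ^ 2 / 8 * e + ((e : ℝ) + S.sb t N e) / 2 ≤ S.sl t N e ∨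
      (S.D : ℝ) + S.w + 20 ≤ S.i ^ 2 * e) ∧
    (S.D : ℝ) / 4 - 10 * (S.w + 2) + S.i ^ 2 / 8 * e ≤ (N : ℝ) - 1 - S.sl t N e := by
  simp only [K1, Finset.mem_filter, Finset.mem_range] at he
  obtain ⟨-, h2⟩ := he
  have hi := S.hi
  have hi1 := S.i_lt_one
  have htr : (t : ℝ) ≤ 1 := by exact_mod_cast ht
  have hDr : 100 * ((S.w : ℝ) + 1) ≤ S.D := by exact_mod_cast hD
  have hw0 : (0 : ℝ) ≤ S.w := by positivity
  have he0 : (0 : ℝ) ≤ e := by positivity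
  have hsb : S.sb t N e + e + S.D = 2 * N + t + 4 + 2 * S.w := by unfold sb; omega
  have hsbr : (S.sb t N e : ℝ) + e + S.D = 2 * N + t + 4 + 2 * S.w := by exact_mod_cast hsb
  have hb0 : (0 : ℝ) ≤ S.sb t N e := by positivity
  have hie : S.i ^ 2 * e ≤ e := by
    have : S.i ^ 2 ≤ 1 := by nlinarith
    nlinarith
  have hie0 : 0 ≤ S.i ^ 2 * e := by positivity
  refine ⟨by linarith, ?_, ?_, ?_⟩
  · unfold sl
    split_ifs with hc
    · exact Nat.le_ceil _
    · refine le_trans ?_ (Nat.le_ceil _)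
      linarith
  · unfold sl
    split_ifs with hc
    · right; exact hc
    · left; exact Nat.le_ceil _
  · unfold sl
    split_ifs with hc
    · have := Nat.ceil_lt_add_one (a := (S.w + 6) - S.i ^ 2 / 8 * e + ((e : ℝ) + S.sb t N e) / 2)
        (by linarith)
      linarith
    · have := Nat.ceil_lt_add_one (a := (S.w + 6) + S.i ^ 2 / 8 * e + ((e : ℝ) + S.sb t N e) / 2)
        (by linarith)
      push Not at hc
      linarith

lemma inh_bounds {S : Ctx} {N e : ℕ} (he : e ∈ S.K3 N) (hD : 100 * (S.w + 1) ≤ S.D) :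
    (N : ℝ) ≤ 2 * S.D - S.w - 1 + (1 + S.i) * e ∧
    2 * S.D - S.w - 1 + (1 + S.i) * e < (N : ℝ) + 1 ∧
    (S.D : ℝ) / 4 - 10 * (S.w + 2) ≤ (N : ℝ) - 1 - ⌈S.D + 2 * (S.w : ℝ) + 3 + (1 + S.i) * e⌉₊ := by
  simp only [K3, Finset.mem_filter, Finset.mem_range] at he
  obtain ⟨-, h2⟩ := he
  have hi := S.hi
  have hDr : 100 * ((S.w : ℝ) + 1) ≤ S.D := by exact_mod_cast hD
  have hw0 : (0 : ℝ) ≤ S.w := by positivity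
  have he0 : (0 : ℝ) ≤ (1 + S.i) * e := by positivity
  have a1 : (N : ℝ) ≤ 2 * S.D - S.w - 1 + (1 + S.i) * e := by
    rw [h2]; exact Nat.floor_le (by linarith)
  have a2 : 2 * S.D - S.w - 1 + (1 + S.i) * e < (N : ℝ) + 1 := by
    rw [h2]; exact Nat.lt_floor_add_one _
  refine ⟨a1, a2, ?_⟩
  have := Nat.ceil_lt_add_one (a := S.D + 2 * (S.w : ℝ) + 3 + (1 + S.i) * e) (by linarith)
  linarith

/-- lower bound for the drop in levels, and positivity -/
lemma ll_bound {S : Ctx} {N : ℕ} (hD : 100 * (S.w + 1) ≤ S.D) : ∀ κ ∈ S.K N,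
    S.ll N κ < N ∧ (S.D : ℝ) / 4 - 10 * (S.w + 2) +
      ![S.i ^ 2 / 8 * S.kk N κ.2, S.i ^ 2 / 8 * κ.2, S.i ^ 2 / 8 * κ.2, 0] κ.1
      ≤ ((N - 1 - S.ll N κ : ℕ) : ℝ) := by
  have hi := S.hi
  have hi1 := S.i_lt_one
  have hDr : 100 * ((S.w : ℝ) + 1) ≤ S.D := by exact_mod_cast hD
  have hw0 : (0 : ℝ) ≤ S.w := by positivity
  have fin : ∀ {l : ℕ} {x : ℝ}, x ≤ (N : ℝ) - 1 - l → l + 1 ≤ (N : ℝ) →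
      l < N ∧ x ≤ ((N - 1 - l : ℕ) : ℝ) := by
    intro l x h1 h2
    have h3 : l + 1 ≤ N := by exact_mod_cast h2
    refine ⟨h3, ?_⟩
    rw [Nat.sub_sub, Nat.cast_sub (by omega)]
    push_cast; linarith
  apply K_cases
  · intro e he
    obtain ⟨h1, h2, h3, h4⟩ := rm_bounds he hD
    have hcast : ((S.rn N + (S.w + 6) - S.rm N e : ℕ) : ℝ) = S.rn N + (S.w + 6) - S.rm N e := by
      rw [Nat.cast_sub h2]; push_cast; ring
    apply fin
    · simp only [ll, Matrix.cons_val_zero]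
      rw [hcast, h1]; linarith
    · simp only [ll, Matrix.cons_val_zero]
      have : (0 : ℝ) ≤ S.rm N e := by positivity
      rw [hcast, h1]; linarith
  · intro e he
    obtain ⟨h1, h2, h3, h4⟩ := sl_bounds (by norm_num) he hD
    have : 0 ≤ S.i ^ 2 / 8 * e := by positivity
    apply fin
    · simpa [ll] using h4
    · simp only [ll, Matrix.cons_val_one, Matrix.cons_val_zero]
      linarith
  · intro e he
    obtain ⟨h1, h2, h3, h4⟩ := sl_bounds (by norm_num) he hD
    have : 0 ≤ S.i ^ 2 / 8 * e := by positivity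
    apply fin
    · simpa [ll] using h4
    · simp only [ll, Matrix.cons_val]
      linarith
  · intro e he
    obtain ⟨h1, h2, h3⟩ := inh_bounds he hD
    apply fin
    · simpa [ll] using h3
    · simp only [ll, Matrix.cons_val]
      linarith

lemma geo {ν : ℝ} (hν : 0 < ν) (z : ℝ) (T : Finset ℕ) (hT : ∀ e ∈ T, z ≤ e) :
    ∑ e ∈ T, E (-(ν * (e - z))) ≤ (1 - E (-ν))⁻¹ := by
  set a := ⌈z⌉₊ with ha
  have hge : ∀ e ∈ T, a ≤ e := fun e he => Nat.ceil_le.2 (hT e he)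
  have h1 : E (-ν) < 1 := E_lt_one (by linarith)
  calc ∑ e ∈ T, E (-(ν * (e - z))) ≤ ∑ e ∈ T, E (-ν) ^ (e - a) := by
        apply Finset.sum_le_sum
        intro e he
        have h2 : E (-ν) ^ (e - a) = E (-ν * (e - a : ℕ)) := by rw [← E_rpow, Real.rpow_natCast]
        rw [h2, Nat.cast_sub (hge e he)]
        apply E_le
        have : z ≤ a := Nat.le_ceil z
        nlinarith
    _ = ∑ d ∈ T.image (fun e => e - a), E (-ν) ^ d := by
        rw [Finset.sum_image]
        intro x hx y hy hxy
        have := hge x hx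
        have := hge y hy
        simp only at hxy
        omega
    _ ≤ ∑' d : ℕ, E (-ν) ^ d :=
        (summable_geometric_of_lt_one (E_pos _).le h1).sum_le_tsum _ (fun _ _ => by have := E_pos (-ν); positivity)
    _ = _ := tsum_geometric_of_lt_one (E_pos _).le h1

lemma K_sum {S : Ctx} {N : ℕ} {s : ℝ} (hs : 0 < s) (hD : 100 * (S.w + 1) ≤ S.D) :
    ∑ κ ∈ S.K N, 7 * (((2 : ℝ) ^ s)⁻¹) ^ (N - 1 - S.ll N κ) ≤
      28 * ((1 - E (-(s * (S.i ^ 2 / 8))))⁻¹ * E (-(s * (S.D / 4 - 11 * (S.w + 2))))) := by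
  have hi := S.hi
  have hi1 := S.i_lt_one
  have hi2 : 0 < S.i ^ 2 := by positivity
  have hi2' : S.i ^ 2 ≤ 1 := by nlinarith
  have hw0 : (0 : ℝ) ≤ S.w := by positivity
  set R := E (-(s * (S.D / 4 - 11 * (S.w + 2)))) with hR
  have hR0 : 0 < R := E_pos _
  set ν := s * (S.i ^ 2 / 8) with hν
  have hν0 : 0 < ν := by positivity
  have hone : 1 ≤ (1 - E (-ν))⁻¹ := by
    have h1 : E (-ν) < 1 := E_lt_one (by linarith)
    have h2 := E_pos (-ν)
    exact (one_le_inv₀ (by linarith)).2 (by linarith)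
  have hpw : ∀ d : ℕ, (((2 : ℝ) ^ s)⁻¹) ^ d = E (-(s * d)) := by
    intro d
    rw [show ((2 : ℝ) ^ s)⁻¹ = E (-s) by rw [E_neg]; rfl, ← Real.rpow_natCast, E_rpow]; ring_nf
  have hb := ll_bound (S := S) (N := N) hD
  have hterm : ∀ κ ∈ S.K N, 7 * (((2 : ℝ) ^ s)⁻¹) ^ (N - 1 - S.ll N κ) ≤
      7 * E (-(s * (S.D / 4 - 10 * (S.w + 2) +
        ![S.i ^ 2 / 8 * S.kk N κ.2, S.i ^ 2 / 8 * κ.2, S.i ^ 2 / 8 * κ.2, 0] κ.1))) := by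
    intro κ hκ
    rw [hpw]
    have := mul_le_mul_of_nonneg_left (hb κ hκ).2 hs.le
    have := E_le (neg_le_neg this)
    linarith
  refine (Finset.sum_le_sum hterm).trans ?_
  unfold K
  rw [Finset.sum_sigma, Fin.sum_univ_four]
  simp only [Matrix.cons_val]
  have c1 : ∀ t, ∑ e ∈ S.K1 t N, 7 * E (-(s * (S.D / 4 - 10 * (S.w + 2) + S.i ^ 2 / 8 * e))) ≤
      7 * ((1 - E (-ν))⁻¹ * R) := by
    intro t
    have := geo hν0 0 (S.K1 t N) (fun e _ => by positivity)
    calc _ ≤ ∑ e ∈ S.K1 t N, 7 * (E (-(ν * (e - 0))) * R) := by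
          apply Finset.sum_le_sum
          intro e _
          rw [hR, E_mul]
          have : E (-(s * (S.D / 4 - 10 * (S.w + 2) + S.i ^ 2 / 8 * e))) ≤
            E (-(ν * (e - 0)) + -(s * (S.D / 4 - 11 * (S.w + 2)))) := by
            apply E_le
            rw [hν]
            have : 0 ≤ s * (S.w + 2) := by positivity
            nlinarith
          linarith
      _ = 7 * ((∑ e ∈ S.K1 t N, E (-(ν * (e - 0)))) * R) := by
          rw [Finset.sum_mul, Finset.mul_sum]
      _ ≤ _ := by
          have := mul_le_mul_of_nonneg_right this hR0.le
          linarith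
  have c0 : ∑ e ∈ S.K0 N, 7 * E (-(s * (S.D / 4 - 10 * (S.w + 2) + S.i ^ 2 / 8 * S.kk N e))) ≤
      7 * ((1 - E (-ν))⁻¹ * R) := by
    set z : ℝ := (S.rn N - (S.w + 2)) / (1 + S.i) with hz
    have hz' : (1 + S.i) * z = S.rn N - (S.w + 2) := by rw [hz]; field_simp
    have hez : ∀ e ∈ S.K0 N, z ≤ e := by
      intro e he
      simp only [K0, Finset.mem_filter] at he
      have := he.2.2
      unfold kk at this
      rw [hz, div_le_iff₀ (by linarith)]
      linarith
    have := geo hν0 z (S.K0 N) hez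
    calc _ ≤ ∑ e ∈ S.K0 N, 7 * (E (-(ν * (e - z))) * R) := by
          apply Finset.sum_le_sum
          intro e he
          rw [hR, E_mul]
          have : E (-(s * (S.D / 4 - 10 * (S.w + 2) + S.i ^ 2 / 8 * S.kk N e))) ≤
            E (-(ν * (e - z)) + -(s * (S.D / 4 - 11 * (S.w + 2)))) := by
            apply E_le
            have h3 : e - z - (S.w + 2) ≤ S.kk N e := by
              have : S.kk N e = (1 + S.i) * (e - z) - (S.w + 2) := by
                unfold kk; rw [mul_sub, hz']; ring
              rw [this]
              have := hez e he
              nlinarith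
            have h4 : ν * (e - z - (S.w + 2)) ≤ ν * S.kk N e := mul_le_mul_of_nonneg_left h3 hν0.le
            have h5 : ν * (S.w + 2) ≤ s * (S.w + 2) := by
              apply mul_le_mul_of_nonneg_right _ (by positivity)
              rw [hν]; nlinarith
            have h6 : ν * S.kk N e = s * (S.i ^ 2 / 8 * S.kk N e) := by rw [hν]; ring
            nlinarith
          linarith
      _ = 7 * ((∑ e ∈ S.K0 N, E (-(ν * (e - z)))) * R) := by
          rw [Finset.sum_mul, Finset.mul_sum]
      _ ≤ _ := by
          have := mul_le_mul_of_nonneg_right this hR0.le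
          linarith
  have c3 : ∑ e ∈ S.K3 N, 7 * E (-(s * (S.D / 4 - 10 * (S.w + 2) + 0))) ≤
      7 * ((1 - E (-ν))⁻¹ * R) := by
    have hcard : (S.K3 N).card ≤ 1 := by
      rw [Finset.card_le_one]
      intro x hx y hy
      obtain ⟨a1, a2, -⟩ := inh_bounds hx hD
      obtain ⟨b1, b2, -⟩ := inh_bounds hy hD
      have key : ∀ a b : ℕ, a < b → (1 + S.i) * b - (1 + S.i) * a < 1 → False := by
        intro a b hab h
        have : (a : ℝ) + 1 ≤ b := by exact_mod_cast hab
        nlinarith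
      rcases lt_trichotomy x y with h | h | h
      · exact (key x y h (by linarith)).elim
      · exact h
      · exact (key y x h (by linarith)).elim
    rw [Finset.sum_const, nsmul_eq_mul]
    have h1 : ((S.K3 N).card : ℝ) ≤ 1 := by exact_mod_cast hcard
    have h2 : E (-(s * (S.D / 4 - 10 * (S.w + 2) + 0))) ≤ R := by
      apply E_le
      have : 0 ≤ s * (S.w + 2) := by positivity
      nlinarith
    have h3 := E_pos (-(s * (S.D / 4 - 10 * (S.w + 2) + 0)))
    have h4 : R ≤ (1 - E (-ν))⁻¹ * R := by nlinarith
    nlinarith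
  have := c1 0
  have := c1 1
  linarith


lemma Z_red {S : Ctx} {q : ℕ} {p r : ℤ} {u : ℝ} (hq : 0 < q) (hz : S.Z q p r u) :
    ∃ (q' : ℕ) (p' r' : ℤ), 0 < q' ∧ q' ≤ q ∧ Red q' p' r' ∧ S.Z q' p' r' u := by
  obtain ⟨q', p', r', h0, hle, hred, e1, e2⟩ := exists_red q hq p r
  refine ⟨q', p', r', h0, hle, hred, ?_⟩
  have hq0 : (0 : ℝ) < q := by exact_mod_cast hq
  have h0r : (0 : ℝ) < q' := by exact_mod_cast h0
  have hler : (q' : ℝ) ≤ q := by exact_mod_cast hle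
  have gen : ∀ {x y : ℝ} {a a' : ℤ}, 0 < y → (q' : ℤ) * a = q * a' →
      |q * x - a| ≤ E (-S.D) * (q : ℝ) ^ (-y) → |q' * x - a'| ≤ E (-S.D) * (q' : ℝ) ^ (-y) := by
    intro x y a a' hy ha h
    have har : (q' : ℝ) * a = q * a' := by exact_mod_cast ha
    have h1 : |(q : ℝ) * (q' * x - a')| = q' * |q * x - a| := by
      rw [show (q : ℝ) * (q' * x - a') = q' * (q * x - a) by linear_combination har, abs_mul,
        abs_of_pos h0r]
    rw [abs_mul, abs_of_pos hq0] at h1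
    have h2 : (q : ℝ) * |q' * x - a'| ≤ q * |q * x - a| := by
      rw [h1]; exact mul_le_mul_of_nonneg_right hler (abs_nonneg _)
    have h3 := le_of_mul_le_mul_left h2 hq0
    refine h3.trans (h.trans ?_)
    apply mul_le_mul_of_nonneg_left _ (E_pos _).le
    exact Real.rpow_le_rpow_of_nonpos h0r hler (by linarith)
  exact ⟨gen S.hi e1 hz.1, gen S.hj e2 hz.2⟩

lemma E_log (q : ℕ) (hq : 0 < q) : E (Nat.log 2 q) ≤ q ∧ (q : ℝ) < E (Nat.log 2 q + 1) := by
  constructor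
  · rw [E_nat]; exact_mod_cast Nat.pow_log_le_self 2 hq.ne'
  · rw [← Nat.cast_succ, E_nat]
    exact_mod_cast Nat.lt_pow_succ_log_self (by norm_num) q

lemma level {S : Ctx} (γ δ : ℝ) (hD : 100 * (S.w + 1) ≤ S.D) {q : ℕ} {p r : ℤ} {u y : ℝ}
    (hu : u ∈ Icc (0 : ℝ) 1) (hq : 0 < q) (hz : S.Z q p r u) (hy : (q : ℝ) ≤ E y) :
    ∃ N, ∃ κ ∈ S.K N, u ∈ S.BB γ δ N κ ∧ (N : ℝ) ≤ S.D + (1 + S.i) * y := by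
  obtain ⟨q', p', r', h0, hle, hred, hz'⟩ := Z_red hq hz
  have hy' : (q' : ℝ) ≤ E y := le_trans (by exact_mod_cast hle) hy
  clear hz hy hle hq
  obtain ⟨hl1, hl2⟩ := E_log q' h0
  set e := Nat.log 2 q' with he
  have hat : S.At e q' p' r' u := ⟨hl1, hl2, hred, hz'⟩
  have hey : (e : ℝ) ≤ y := E_le_iff.1 (hl1.trans hy')
  obtain ⟨fA, fB, -⟩ := hat.facts
  have hne := S.vne (p := p') (r := r') h0
  have hi := S.hi
  have hj := S.hj
  have hij := S.hij
  have hi1 := S.i_lt_one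
  have hDr : 100 * ((S.w : ℝ) + 1) ≤ S.D := by exact_mod_cast hD
  have hw0 : (0 : ℝ) ≤ S.w := by positivity
  have he0 : (0 : ℝ) ≤ e := by positivity
  have hii : 0 ≤ S.i ^ 2 / 4 * e := by positivity
  have hiey : (1 + S.i) * e ≤ (1 + S.i) * y := by nlinarith
  by_cases hc : E (S.i ^ 2 / 4 * e - e) * |((S.V q' p' r').2.1 : ℝ)| ≤ S.G (S.V q' p' r') u ^ 2
  · -- regular
    have hGlow : E (-((e : ℝ) / 2)) ≤ |S.G (S.V q' p' r') u| := by
      by_cases hB : (S.V q' p' r').2.1 = 0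
      · have hA : (S.V q' p' r').1 ≠ 0 := by tauto
        have h1 : (1 : ℝ) ≤ |((S.V q' p' r').1 : ℝ)| := by
          exact_mod_cast Int.one_le_abs hA
        have h2 : S.G (S.V q' p' r') u = (S.V q' p' r').1 := by unfold G; rw [hB]; simp
        rw [h2]
        refine le_trans ?_ h1
        rw [← E_zero]; apply E_le; linarith
      · have h1 : (1 : ℝ) ≤ |((S.V q' p' r').2.1 : ℝ)| := by
          exact_mod_cast Int.one_le_abs hB
        refine (sq_le_sq₀ (E_pos _).le (abs_nonneg _)).1 ?_
        rw [E_sq, sq_abs]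
        refine le_trans ?_ hc
        calc E (2 * -((e : ℝ) / 2)) ≤ E (S.i ^ 2 / 4 * e - e) * 1 := by
              rw [mul_one]; apply E_le; linarith
          _ ≤ _ := mul_le_mul_of_nonneg_left h1 (E_pos _).le
    have hGpos : 0 < |S.G (S.V q' p' r') u| := (E_pos _).trans_le hGlow
    obtain ⟨h, hh1, hh2⟩ := exists_mem_Ico_zpow hGpos (one_lt_two : (1 : ℝ) < 2)
    have hE1 : E (h : ℝ) ≤ |S.G (S.V q' p' r') u| := by
      unfold E; rw [Real.rpow_intCast]; exact hh1
    have hE2 : |S.G (S.V q' p' r') u| < E ((h : ℝ) + 1) := by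
      have : ((h : ℝ) + 1) = ((h + 1 : ℤ) : ℝ) := by push_cast; ring
      rw [this]
      unfold E; rw [Real.rpow_intCast]; exact hh2
    have hlow : -((e : ℝ) / 2) < h + 1 := E_lt_iff.1 (hGlow.trans_lt hE2)
    have hlow' : (-(e : ℤ)) < 2 * h + 2 := by
      have : (-(e : ℝ)) < 2 * h + 2 := by linarith
      exact_mod_cast this
    obtain ⟨n, hn⟩ := Int.eq_ofNat_of_zero_le (show 0 ≤ h + e by omega)
    have hnr : (h : ℝ) = n - e := by
      have : (h : ℝ) + e = n := by exact_mod_cast hn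
      linarith
    have hGup : |S.G (S.V q' p' r') u| ≤ E (S.i * (e + 1) + S.w + 1) := by
      unfold G
      refine (abs_add_le _ _).trans ?_
      have h1 : |((S.V q' p' r').2.1 : ℝ) * S.W u| ≤ E (S.i * (e + 1) + S.w) := by
        rw [abs_mul, ← E_mul]
        apply mul_le_mul (fB.trans (E_le ?_)) (S.hW0 u hu) (abs_nonneg _) (E_pos _).le
        have := S.hji
        nlinarith
      refine (add_le_add fA h1).trans (E_add_le ?_ ?_) <;> linarith
    have hup : (h : ℝ) ≤ S.i * (e + 1) + S.w + 1 := E_le_iff.1 (hE1.trans hGup)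
    have hDn : S.w + 3 ≤ S.D := by omega
    have hrn : S.rn (n + S.D - (S.w + 3)) = n := by unfold rn; omega
    refine ⟨n + S.D - (S.w + 3), ⟨0, e⟩, ?_, ?_, ?_⟩
    · simp only [K, Finset.mem_sigma, Finset.mem_univ, true_and, Matrix.cons_val_zero, K0,
        Finset.mem_filter, Finset.mem_range]
      refine ⟨by rw [hrn]; omega, by omega, ?_⟩
      unfold kk
      rw [hrn]
      linarith
    · simp only [BB, Matrix.cons_val_zero]
      rw [hrn]
      refine ⟨hu, q', p', r', hat, hc, ?_, ?_⟩
      · rw [← hnr]; exact hE1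
      · rw [← hnr]; exact hE2
    · rw [Nat.cast_sub (by omega)]
      push_cast
      linarith
  · push Not at hc
    have hB : (S.V q' p' r').2.1 ≠ 0 := by
      intro h
      rw [h] at hc
      simp only [Int.cast_zero, abs_zero, mul_zero] at hc
      exact absurd hc (not_lt.2 (sq_nonneg _))
    obtain ⟨g1, g2⟩ := E_log (S.V q' p' r').2.1.natAbs (Int.natAbs_pos.2 hB)
    set β := Nat.log 2 (S.V q' p' r').2.1.natAbs with hβ
    have hcast : (((S.V q' p' r').2.1.natAbs : ℕ) : ℝ) = |((S.V q' p' r').2.1 : ℝ)| := by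
      rw [← Int.cast_natCast, Int.natCast_natAbs, Int.cast_abs]
    rw [hcast] at g1 g2
    have hβj : (β : ℝ) ≤ S.j * (e + 1) := E_le_iff.1 (g1.trans fB)
    have hmem : u ∈ S.Spec e β := ⟨hu, q', p', r', hat, hc, g1, g2⟩
    have hje : S.j * e ≤ e := by nlinarith
    have hie : 0 ≤ S.i * e := by positivity
    have hNb : ∀ N t : ℕ, 2 * N + t + 4 + 2 * S.w = S.D + e + β → (N : ℝ) ≤ S.D + (1 + S.i) * y := by
      intro N t h
      have : 2 * (N : ℝ) + t + 4 + 2 * S.w = S.D + e + β := by exact_mod_cast h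
      have : (0 : ℝ) ≤ t := by positivity
      linarith
    set a := S.D + e + β - (4 + 2 * S.w) with ha
    rcases Nat.even_or_odd' a with ⟨N, hN | hN⟩
    · have hsb : S.sb 0 N e = β := by unfold sb; omega
      refine ⟨N, ⟨1, e⟩, ?_, ?_, hNb N 0 (by omega)⟩
      · simp only [K, Finset.mem_sigma, Finset.mem_univ, true_and, Matrix.cons_val, K1,
          Finset.mem_filter, Finset.mem_range]
        omega
      · simp only [BB, Matrix.cons_val]
        rw [hsb]; exact hmem
    · have hsb : S.sb 1 N e = β := by unfold sb; omega
      refine ⟨N, ⟨2, e⟩, ?_, ?_, hNb N 1 (by omega)⟩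
      · simp only [K, Finset.mem_sigma, Finset.mem_univ, true_and, Matrix.cons_val, K1,
          Finset.mem_filter, Finset.mem_range]
        omega
      · simp only [BB, Matrix.cons_val]
        rw [hsb]; exact hmem

lemma isJ_of_good {S : Ctx} (γ δ : ℝ) (hD : 100 * (S.w + 1) ≤ S.D) {l k : ℕ} (hk : k < 2 ^ l)
    (hgood : ∀ N' ≤ l, ∀ κ' ∈ S.K N', Disjoint (dyI l k) (S.BB γ δ N' κ')) : S.IsJ l (dyI l k) := by
  have h2 : (0 : ℝ) < 2 ^ l := by positivity
  have hsub : dyI l k ⊆ Icc (0 : ℝ) 1 := by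
    intro x hx
    refine ⟨le_trans (by positivity) hx.1, hx.2.trans ?_⟩
    rw [div_le_one h2]
    exact_mod_cast hk
  refine ⟨hsub, ordConnected_Icc, ?_, ?_⟩
  · intro s hs t ht
    rw [E_neg, E_nat]
    have : (((k : ℝ) + 1) / 2 ^ l) = k / 2 ^ l + (2 ^ l)⁻¹ := by field_simp
    have a := hs.1
    have b := hs.2
    have c := ht.1
    have d := ht.2
    rw [abs_le]; constructor <;> linarith
  · intro y hy u hu q p r hq hqy hz
    obtain ⟨N, κ, hκ, hB, hN⟩ := level γ δ hD (hsub hu) hq hz hqy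
    have : N ≤ l := by exact_mod_cast hN.trans hy
    exact (Set.disjoint_left.1 (hgood N this κ hκ)) hu hB

lemma hsep {S : Ctx} (γ δ : ℝ) (hD : 100 * (S.w + 1) ≤ S.D) : ∀ N, ∀ κ ∈ S.K N, ∀ k < 2 ^ (S.ll N κ),
    (∀ N' ≤ S.ll N κ, ∀ κ' ∈ S.K N', Disjoint (dyI (S.ll N κ) k) (S.BB γ δ N' κ')) →
    ∀ u1 ∈ S.BB γ δ N κ ∩ dyI (S.ll N κ) k, ∀ u2 ∈ S.BB γ δ N κ ∩ dyI (S.ll N κ) k,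
    ∀ u3 ∈ S.BB γ δ N κ ∩ dyI (S.ll N κ) k, ∀ u4 ∈ S.BB γ δ N κ ∩ dyI (S.ll N κ) k,
    u1 + 1 / 2 ^ N ≤ u2 → u2 + 1 / 2 ^ N ≤ u3 → u3 + 1 / 2 ^ N ≤ u4 → False := by
  intro N
  have hpow : (1 : ℝ) / 2 ^ N = E (-N) := by rw [E_neg, E_nat, one_div]
  have hpos := E_pos (-(N : ℝ))
  have hD10 : 10 ≤ S.D := by omega
  have hDw : S.w ≤ S.D := by omega
  rw [hpow]
  apply K_cases
  · intro e he k hk hgood u1 h1 u2 h2 u3 h3 u4 h4 h12 h23 h34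
    have hJ := isJ_of_good γ δ hD hk hgood
    obtain ⟨a1, a2, a3, -⟩ := rm_bounds he hD
    have hcast : ((S.ll N ⟨0, e⟩ : ℕ) : ℝ) = S.rn N + (S.w + 6) - S.rm N e := by
      simp only [ll, Matrix.cons_val_zero]
      rw [Nat.cast_sub a2]; push_cast; ring
    have := reg_sep hJ hD10 hDw hcast a3 h1.1 h1.2 h3.1 h3.2
    rw [abs_sub_comm, abs_of_pos (by linarith), a1] at this
    have h5 : E (3 + S.w - S.D - (N + S.w + 3 - S.D)) = E (-N) := by ring_nf
    rw [h5] at this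
    linarith
  · intro e he k hk hgood u1 h1 u2 h2 u3 h3 u4 h4 h12 h23 h34
    have hJ := isJ_of_good γ δ hD hk hgood
    obtain ⟨a1, a2, a3, -⟩ := sl_bounds (by norm_num) he hD
    exact spec_sep hJ hD10 hDw a2 a3 (N := N) (by push_cast at a1; linarith) h1 h2 h3 h4 h12 h23 h34
  · intro e he k hk hgood u1 h1 u2 h2 u3 h3 u4 h4 h12 h23 h34
    have hJ := isJ_of_good γ δ hD hk hgood
    obtain ⟨a1, a2, a3, -⟩ := sl_bounds (by norm_num) he hD
    exact spec_sep hJ hD10 hDw a2 a3 (N := N) (by push_cast at a1; linarith) h1 h2 h3 h4 h12 h23 h34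
  · intro e he k hk hgood u1 h1 u2 h2 u3 h3 u4 h4 h12 h23 h34
    have hJ := isJ_of_good γ δ hD hk hgood
    obtain ⟨a1, -, -⟩ := inh_bounds he hD
    have := inh_sep hJ hD10 (Nat.le_ceil _) h1.1 h1.2 h3.1 h3.2
    rw [abs_sub_comm, abs_of_pos (by linarith)] at this
    have h5 := E_le (neg_le_neg a1)
    linarith

/-- avoiding all the inhomogeneous sets -/
lemma avoid {S : Ctx} (γ δ : ℝ) (hD : 100 * (S.w + 1) ≤ S.D) {u : ℝ} (hu : u ∈ Icc (0 : ℝ) 1)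
    (h : ∀ N, ∀ κ ∈ S.K N, u ∉ S.BB γ δ N κ) : ∀ e, u ∉ S.Inh γ δ e := by
  intro e he
  have hi := S.hi
  have hDr : 100 * ((S.w : ℝ) + 1) ≤ S.D := by exact_mod_cast hD
  refine h ⌊2 * (S.D : ℝ) - S.w - 1 + (1 + S.i) * e⌋₊ ⟨3, e⟩ ?_ he
  simp only [K, Finset.mem_sigma, Finset.mem_univ, true_and, Matrix.cons_val, K3,
    Finset.mem_filter, Finset.mem_range, and_true]
  rw [Nat.lt_succ_iff]
  apply Nat.le_floor
  have hw0 : (0 : ℝ) ≤ S.w := by positivity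
  have : 0 ≤ S.i * (e : ℝ) := by positivity
  linarith

lemma avoid_bad {S : Ctx} (γ δ : ℝ) {u : ℝ} (hu : u ∈ Icc (0 : ℝ) 1)
    (h : ∀ e, u ∉ S.Inh γ δ e) : (S.X u, S.Y u) ∈ badPair S.i S.j (γ, δ) := by
  have hi := S.hi
  have hj := S.hj
  set ci := E (-(2 * S.D)) ^ (1 / S.i) with hci
  set cj := E (-(2 * S.D)) ^ (1 / S.j) with hcj
  have hc0 := E_pos (-(2 * S.D))
  have hci0 : 0 < ci := by positivity
  have hcj0 : 0 < cj := by positivity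
  refine ⟨min ci cj, lt_min hci0 hcj0, ?_⟩
  intro q hq
  have hq0 : (0 : ℝ) < q := by exact_mod_cast hq
  have gen : ∀ {x y : ℝ}, 0 < y → E (-(2 * S.D)) * (q : ℝ) ^ (-y) < x →
      min ci cj ≤ E (-(2 * S.D)) ^ (1 / y) → min ci cj / q < x ^ (1 / y) := by
    intro x y hy hx hm
    have h1 : (E (-(2 * S.D)) * (q : ℝ) ^ (-y)) ^ (1 / y) < x ^ (1 / y) :=
      Real.rpow_lt_rpow (by positivity) hx (by positivity)
    have h2 : (E (-(2 * S.D)) * (q : ℝ) ^ (-y)) ^ (1 / y) = E (-(2 * S.D)) ^ (1 / y) / q := by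
      rw [Real.mul_rpow hc0.le (by positivity), ← Real.rpow_mul hq0.le,
        show -y * (1 / y) = -1 by field_simp, Real.rpow_neg_one]
      rfl
    rw [h2] at h1
    exact lt_of_le_of_lt (div_le_div_of_nonneg_right hm hq0.le) h1
  by_contra hcon
  rw [not_lt, max_le_iff] at hcon
  apply h (Nat.log 2 q)
  refine ⟨hu, q, round (q * S.X u - γ), round (q * S.Y u - δ), (E_log q hq).1, (E_log q hq).2, ?_, ?_⟩
  · by_contra hlt
    push Not at hlt
    have := gen hi hlt (min_le_left _ _)
    refine absurd hcon.1 (not_le.2 ?_)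
    refine lt_of_lt_of_eq this ?_
    unfold distNearestInt
    congr 2
    simp only
    ring
  · by_contra hlt
    push Not at hlt
    have := gen hj hlt (min_le_right _ _)
    refine absurd hcon.2 (not_le.2 ?_)
    refine lt_of_lt_of_eq this ?_
    unfold distNearestInt
    congr 2
    simp only
    ring

end Ctx

open MeasureTheory in
theorem core (i j γ δ : ℝ) (w : ℕ) (X Y W : ℝ → ℝ)
    (hi : 0 < i) (hj : 0 < j) (hij : i + j = 1) (hji : j ≤ i)
    (hX1 : ∀ s ∈ Icc (0 : ℝ) 1, ∀ t ∈ Icc (0 : ℝ) 1, |X s - X t| ≤ E w * |s - t|)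
    (hX2 : ∀ s ∈ Icc (0 : ℝ) 1, ∀ t ∈ Icc (0 : ℝ) 1, |s - t| ≤ E w * |X s - X t|)
    (hW1 : ∀ s ∈ Icc (0 : ℝ) 1, ∀ t ∈ Icc (0 : ℝ) 1, |W s - W t| ≤ E w * |s - t|)
    (hW2 : ∀ s ∈ Icc (0 : ℝ) 1, ∀ t ∈ Icc (0 : ℝ) 1, |s - t| ≤ E w * |W s - W t|)
    (hW0 : ∀ s ∈ Icc (0 : ℝ) 1, |W s| ≤ E w)
    (hY : ∀ s ∈ Icc (0 : ℝ) 1, ∀ t ∈ Icc (0 : ℝ) 1, ∃ ξ ∈ uIcc s t, Y s - Y t = W ξ * (X s - X t))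
    (s : ℝ) (hs : 0 < s) (hs1 : s < 1) :
    μH[s] {u : ℝ | u ∈ Icc (0 : ℝ) 1 ∧ (X u, Y u) ∈ badPair i j (γ, δ)} ≠ 0 := by
  choose V hV using exists_MDv i j hi hj hij
  set η : ℝ := (2 - (2 : ℝ) ^ s) / 2 with hη
  have hη0 : 0 < η := by
    have : (2 : ℝ) ^ s < 2 ^ (1 : ℝ) := Real.rpow_lt_rpow_of_exponent_lt (by norm_num) hs1
    rw [Real.rpow_one] at this
    rw [hη]; linarith
  set κ := (1 - E (-(s * (i ^ 2 / 8))))⁻¹ with hκ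
  -- choice of `D`
  obtain ⟨D, hD1, hD2⟩ : ∃ D : ℕ, 100 * (w + 1) ≤ D ∧
      28 * (κ * E (-(s * (D / 4 - 11 * (w + 2))))) ≤ η := by
    have ht : Tendsto (fun D : ℕ => 28 * (κ * E (-(s * (D / 4 - 11 * (w + 2)))))) atTop (nhds 0) := by
      have h1 : ∀ D : ℕ, 28 * (κ * E (-(s * (D / 4 - 11 * (w + 2))))) =
          (28 * (κ * E (s * (11 * (w + 2))))) * E (-(s / 4)) ^ D := by
        intro D
        rw [← Real.rpow_natCast, E_rpow, mul_assoc, mul_assoc, E_mul]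
        ring_nf
      simp_rw [h1]
      have h2 := tendsto_pow_atTop_nhds_zero_of_lt_one (E_pos (-(s / 4))).le
        (E_lt_one (x := -(s / 4)) (by linarith))
      simpa using h2.const_mul (28 * (κ * E (s * (11 * (w + 2)))))
    have h3 := (ht.eventually (ge_mem_nhds hη0)).and (eventually_ge_atTop (100 * (w + 1)))
    obtain ⟨D, h4, h5⟩ := h3.exists
    exact ⟨D, h5, h4⟩
  let S : Ctx := ⟨i, j, D, w, X, Y, W, V, hi, hj, hij, hji, hX1, hX2, hW1, hW2, hW0, hY, hV⟩
  have hDS : 100 * (S.w + 1) ≤ S.D := hD1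
  have main := cantor_hausdorff S.K (S.BB γ δ) S.ll s η hs hs1 hη0
    (fun N κ hκ => (Ctx.ll_bound hDS κ hκ).1) (Ctx.hsep γ δ hDS)
    (fun N => (Ctx.K_sum hs hDS).trans hD2) (by rw [hη]; linarith)
  intro h0
  apply main
  refine measure_mono_null ?_ h0
  rintro u ⟨hu, h⟩
  exact ⟨hu, Ctx.avoid_bad γ δ hu (Ctx.avoid γ δ hDS hu h)⟩


/-- mean value theorem in an unordered form -/
lemma mvt_unordered {a b : ℝ} {g g' : ℝ → ℝ} (h : ∀ x ∈ Ioo a b, HasDerivAt g (g' x) x)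
    (s : ℝ) (hs : s ∈ Ioo a b) (t : ℝ) (ht : t ∈ Ioo a b) :
    ∃ ξ ∈ uIcc s t, g s - g t = g' ξ * (s - t) := by
  have key : ∀ s ∈ Ioo a b, ∀ t ∈ Ioo a b, s < t → ∃ ξ ∈ Icc s t, g t - g s = g' ξ * (t - s) := by
    intro s hs t ht hst
    have hsub : ∀ x ∈ Icc s t, x ∈ Ioo a b := fun x hx =>
      ⟨lt_of_lt_of_le hs.1 hx.1, lt_of_le_of_lt hx.2 ht.2⟩
    obtain ⟨c, hc, hc2⟩ := exists_hasDerivAt_eq_slope g g' hst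
      (fun x hx => (h x (hsub x hx)).continuousAt.continuousWithinAt)
      (fun x hx => h x (hsub x (Ioo_subset_Icc_self hx)))
    refine ⟨c, Ioo_subset_Icc_self hc, ?_⟩
    have : t - s ≠ 0 := by linarith
    rw [hc2]; field_simp
  rcases lt_trichotomy s t with h1 | h1 | h1
  · obtain ⟨ξ, h2, h3⟩ := key s hs t ht h1
    refine ⟨ξ, by rw [uIcc_of_le h1.le]; exact h2, by linarith⟩
  · subst h1
    exact ⟨s, by simp, by simp⟩
  · obtain ⟨ξ, h2, h3⟩ := key t ht s hs h1
    refine ⟨ξ, by rw [uIcc_of_ge h1.le]; exact h2, by linarith⟩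

lemma exists_two_bound {s : Set ℝ} (hs : IsCompact s) {g : ℝ → ℝ} (hg : ContinuousOn g s)
    (h0 : ∀ x ∈ s, g x ≠ 0) : ∃ M : ℝ, 1 ≤ M ∧ ∀ x ∈ s, |g x| ≤ M ∧ 1 ≤ M * |g x| := by
  obtain ⟨A, hA⟩ := hs.exists_bound_of_continuousOn hg
  obtain ⟨B, hB⟩ := hs.exists_bound_of_continuousOn (hg.inv₀ h0)
  refine ⟨max 1 (max A B), le_max_left _ _, fun x hx => ⟨?_, ?_⟩⟩
  · exact (hA x hx).trans ((le_max_left _ _).trans (le_max_right _ _))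
  · have h1 := hB x hx
    have h2 : 0 < |g x| := abs_pos.2 (h0 x hx)
    rw [Real.norm_eq_abs] at h1
    have h3 : |(g x)⁻¹| ≤ max 1 (max A B) := h1.trans ((le_max_right _ _).trans (le_max_right _ _))
    have h4 : |(g x)⁻¹| * |g x| = 1 := by rw [abs_inv]; field_simp
    exact h4.symm.le.trans (mul_le_mul_of_nonneg_right h3 h2.le)

lemma reg_curve (a b : ℝ) (f : ℝ → ℝ) (hab : a < b) (hf : ContDiffOn ℝ 2 f (Set.Icc a b))
    (hf'' : ∀ x ∈ Set.Icc a b, iteratedDerivWithin 2 f (Set.Icc a b) x ≠ 0) :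
    ∃ (a0 ℓ K : ℝ) (d : ℝ → ℝ), 0 < ℓ ∧ 1 ≤ K ∧
      (∀ u ∈ Icc (0 : ℝ) 1, a0 + ℓ * u ∈ Icc a b) ∧ ℓ ≤ K ∧ 1 ≤ K * ℓ ∧
      (∀ u ∈ Icc (0 : ℝ) 1, |d u| ≤ K ∧ 1 ≤ K * |d u|) ∧
      (∀ s ∈ Icc (0 : ℝ) 1, ∀ t ∈ Icc (0 : ℝ) 1,
        |d s - d t| ≤ K * |s - t| ∧ |s - t| ≤ K * |d s - d t| ∧
        ∃ ξ ∈ uIcc s t, f (a0 + ℓ * s) - f (a0 + ℓ * t) = d ξ * (a0 + ℓ * s - (a0 + ℓ * t))) := by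
  have hu : UniqueDiffOn ℝ (Icc a b) := uniqueDiffOn_Icc hab
  set f1 := derivWithin f (Icc a b) with hf1
  set f2 := derivWithin f1 (Icc a b) with hf2
  have e2 : ∀ x, iteratedDerivWithin 2 f (Icc a b) x = f2 x := by
    intro x
    rw [iteratedDerivWithin_succ, hf2]
    congr 1
    funext y
    rw [iteratedDerivWithin_one]
  have c1 : ContDiffOn ℝ 1 f1 (Icc a b) := hf.derivWithin hu (by norm_num)
  have c2 : ContinuousOn f2 (Icc a b) := c1.continuousOn_derivWithin hu le_rfl
  have n2 : ∀ x ∈ Icc a b, f2 x ≠ 0 := fun x hx => e2 x ▸ hf'' x hx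
  have d1 : ∀ x ∈ Ioo a b, HasDerivAt f (f1 x) x := fun x hx =>
    ((hf.differentiableOn (by norm_num) x (Ioo_subset_Icc_self hx)).hasDerivWithinAt).hasDerivAt
      (Icc_mem_nhds hx.1 hx.2)
  have d2 : ∀ x ∈ Ioo a b, HasDerivAt f1 (f2 x) x := fun x hx =>
    ((c1.differentiableOn (by norm_num) x (Ioo_subset_Icc_self hx)).hasDerivWithinAt).hasDerivAt
      (Icc_mem_nhds hx.1 hx.2)
  obtain ⟨x0, hx0, hne⟩ : ∃ x0 ∈ Ioo a b, f1 x0 ≠ 0 := by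
    by_contra! hcon
    have hm1 : (2 * a + b) / 3 ∈ Ioo a b := ⟨by linarith, by linarith⟩
    have hm2 : (a + 2 * b) / 3 ∈ Ioo a b := ⟨by linarith, by linarith⟩
    obtain ⟨ξ, h1, h2⟩ := mvt_unordered d2 _ hm1 _ hm2
    rw [hcon _ hm1, hcon _ hm2] at h2
    have h3 : ξ ∈ Ioo a b := (ordConnected_Ioo.uIcc_subset hm1 hm2) h1
    have h4 := n2 ξ (Ioo_subset_Icc_self h3)
    have h5 : (2 * a + b) / 3 - (a + 2 * b) / 3 ≠ 0 := by
      intro h; linarith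
    exact mul_ne_zero h4 h5 (by linarith)
  have hev : ∀ᶠ x in nhds x0, x ∈ Ioo a b ∧ f1 x ≠ 0 :=
    Filter.Eventually.and (Ioo_mem_nhds hx0.1 hx0.2) ((d2 x0 hx0).continuousAt.eventually_ne hne)
  obtain ⟨ε, hε, hball⟩ := Metric.eventually_nhds_iff.1 hev
  set ℓ := ε / 2 with hℓ
  have hℓ0 : 0 < ℓ := by positivity
  set J := Icc x0 (x0 + ℓ) with hJ
  have hJs : ∀ x ∈ J, x ∈ Ioo a b ∧ f1 x ≠ 0 := by
    intro x hx
    apply hball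
    rw [Real.dist_eq, abs_lt]
    constructor <;> linarith [hx.1, hx.2]
  obtain ⟨M1, hM1, hb1⟩ := exists_two_bound (isCompact_Icc : IsCompact J)
    (g := f1) (fun x hx => (d2 x (hJs x hx).1).continuousAt.continuousWithinAt)
    (fun x hx => (hJs x hx).2)
  obtain ⟨M2, hM2, hb2⟩ := exists_two_bound (isCompact_Icc : IsCompact J)
    (g := f2) (c2.mono fun x hx => Ioo_subset_Icc_self (hJs x hx).1)
    (fun x hx => n2 x (Ioo_subset_Icc_self (hJs x hx).1))
  have hmap : ∀ u ∈ Icc (0 : ℝ) 1, x0 + ℓ * u ∈ J := by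
    intro u hu
    constructor
    · nlinarith [hu.1]
    · nlinarith [hu.2]
  set K := M1 + (M2 * ℓ + M2 / ℓ) + ℓ + 1 / ℓ with hK
  have p1 : 0 < M2 * ℓ := by positivity
  have p2 : 0 < M2 / ℓ := by positivity
  have p3 : 0 < 1 / ℓ := by positivity
  have kM1 : M1 ≤ K := by linarith
  refine ⟨x0, ℓ, K, fun u => f1 (x0 + ℓ * u), hℓ0, by linarith, ?_, by linarith, ?_, ?_, ?_⟩
  · intro u hu
    exact Ioo_subset_Icc_self (hJs _ (hmap u hu)).1
  · have : 1 / ℓ ≤ K := by linarith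
    rwa [div_le_iff₀ hℓ0] at this
  · intro u hu
    obtain ⟨h1, h2⟩ := hb1 _ (hmap u hu)
    exact ⟨h1.trans kM1, h2.trans (mul_le_mul_of_nonneg_right kM1 (abs_nonneg _))⟩
  · intro s hs t ht
    have hs1 := hmap s hs
    have ht1 := hmap t ht
    obtain ⟨ξ, h1, h2⟩ := mvt_unordered d2 _ (hJs _ hs1).1 _ (hJs _ ht1).1
    have hξ : ξ ∈ J := (ordConnected_Icc.uIcc_subset hs1 ht1) h1
    obtain ⟨q1, q2⟩ := hb2 ξ hξ
    have h3 : |f1 (x0 + ℓ * s) - f1 (x0 + ℓ * t)| = |f2 ξ| * (ℓ * |s - t|) := by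
      rw [h2, abs_mul, show x0 + ℓ * s - (x0 + ℓ * t) = ℓ * (s - t) by ring, abs_mul,
        abs_of_pos hℓ0]
    have hst := abs_nonneg (s - t)
    refine ⟨?_, ?_, ?_⟩
    · show |f1 (x0 + ℓ * s) - f1 (x0 + ℓ * t)| ≤ _
      rw [h3]
      calc |f2 ξ| * (ℓ * |s - t|) ≤ M2 * (ℓ * |s - t|) := by gcongr
        _ = (M2 * ℓ) * |s - t| := by ring
        _ ≤ K * |s - t| := by
          apply mul_le_mul_of_nonneg_right _ hst
          linarith
    · show _ ≤ K * |f1 (x0 + ℓ * s) - f1 (x0 + ℓ * t)|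
      rw [h3]
      calc |s - t| = 1 * |s - t| := by ring
        _ ≤ (M2 * |f2 ξ|) * |s - t| := by gcongr
        _ = M2 / ℓ * (|f2 ξ| * (ℓ * |s - t|)) := by field_simp
        _ ≤ K * (|f2 ξ| * (ℓ * |s - t|)) := by
          apply mul_le_mul_of_nonneg_right _ (by positivity)
          linarith
    · obtain ⟨ζ, z1, z2⟩ := mvt_unordered d1 _ (hJs _ hs1).1 _ (hJs _ ht1).1
      refine ⟨(ζ - x0) / ℓ, ?_, ?_⟩
      · rw [mem_uIcc] at z1 ⊢
        rcases z1 with ⟨z, z'⟩ | ⟨z, z'⟩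
        · left
          rw [le_div_iff₀ hℓ0, div_le_iff₀ hℓ0]
          constructor <;> linarith
        · right
          rw [le_div_iff₀ hℓ0, div_le_iff₀ hℓ0]
          constructor <;> linarith
      · have : x0 + ℓ * ((ζ - x0) / ℓ) = ζ := by field_simp; ring
        simp only [this]
        exact z2

lemma badPair_swap (i j γ δ x y : ℝ) (h : (y, x) ∈ badPair j i (δ, γ)) :
    (x, y) ∈ badPair i j (γ, δ) := by
  obtain ⟨c, hc, h1⟩ := h
  refine ⟨c, hc, fun q hq => ?_⟩
  rw [max_comm]
  exact h1 q hq

lemma core_curve (i j γ δ a b : ℝ) (f : ℝ → ℝ) (hi : 0 < i) (hj : 0 < j) (hij : i + j = 1)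
    (hab : a < b) (hf : ContDiffOn ℝ 2 f (Set.Icc a b))
    (hf'' : ∀ x ∈ Set.Icc a b, iteratedDerivWithin 2 f (Set.Icc a b) x ≠ 0) :
    ∃ a0 ℓ : ℝ, 0 < ℓ ∧ (∀ u ∈ Icc (0 : ℝ) 1, a0 + ℓ * u ∈ Icc a b) ∧
      ∀ s : ℝ, 0 < s → s < 1 → MeasureTheory.Measure.hausdorffMeasure s {u : ℝ | u ∈ Icc (0 : ℝ) 1 ∧
        (a0 + ℓ * u, f (a0 + ℓ * u)) ∈ badPair i j (γ, δ)} ≠ 0 := by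
  obtain ⟨a0, ℓ, K, d, hℓ, hK, hmem, hk1, hk2, hd, hst⟩ := reg_curve a b f hab hf hf''
  refine ⟨a0, ℓ, hℓ, hmem, fun σ hσ hσ1 => ?_⟩
  obtain ⟨w, hw⟩ := pow_unbounded_of_one_lt (K ^ 3) (by norm_num : (1 : ℝ) < 2)
  have hKw : K ^ 3 ≤ E w := by rw [E_nat]; exact hw.le
  have hK0 : 0 < K := by linarith
  have k1 : K ≤ E w := le_trans (by nlinarith [sq_nonneg K, mul_pos hK0 hK0, pow_le_pow_right₀ hK (show 1 ≤ 3 by norm_num)]) hKw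
  have k2 : K * K ≤ E w := by
    refine le_trans ?_ hKw
    rw [← pow_two]
    exact pow_le_pow_right₀ hK (by norm_num)
  have hx : ∀ s t : ℝ, |a0 + ℓ * s - (a0 + ℓ * t)| = ℓ * |s - t| := by
    intro s t
    rw [show a0 + ℓ * s - (a0 + ℓ * t) = ℓ * (s - t) by ring, abs_mul, abs_of_pos hℓ]
  have lift : ∀ {y z C : ℝ}, 0 ≤ z → y ≤ C * z → C ≤ E w → y ≤ E w * z := by
    intro y z C hz h1 h2
    exact h1.trans (mul_le_mul_of_nonneg_right h2 hz)
  have hx1 : ∀ s t : ℝ, |a0 + ℓ * s - (a0 + ℓ * t)| ≤ K * |s - t| := by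
    intro s t
    rw [hx]; gcongr
  have hx2 : ∀ s t : ℝ, |s - t| ≤ K * |a0 + ℓ * s - (a0 + ℓ * t)| := by
    intro s t
    rw [hx, ← mul_assoc]
    nlinarith [abs_nonneg (s - t)]
  have hsub : ∀ s ∈ Icc (0 : ℝ) 1, ∀ t ∈ Icc (0 : ℝ) 1, ∀ ξ ∈ uIcc s t, ξ ∈ Icc (0 : ℝ) 1 :=
    fun s hs t ht ξ h => (ordConnected_Icc.uIcc_subset hs ht) h
  rcases le_total j i with hji | hji
  · exact core i j γ δ w (fun u => a0 + ℓ * u) (fun u => f (a0 + ℓ * u)) d hi hj hij hji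
      (fun s _ t _ => lift (abs_nonneg _) (hx1 s t) k1)
      (fun s _ t _ => lift (abs_nonneg _) (hx2 s t) k1)
      (fun s hs t ht => lift (abs_nonneg _) (hst s hs t ht).1 k1)
      (fun s hs t ht => lift (abs_nonneg _) (hst s hs t ht).2.1 k1)
      (fun s hs => (hd s hs).1.trans k1)
      (fun s hs t ht => (hst s hs t ht).2.2) σ hσ hσ1
  · have hd0 : ∀ u ∈ Icc (0 : ℝ) 1, d u ≠ 0 := by
      intro u hu h0
      have := (hd u hu).2
      rw [h0] at this
      norm_num at this
    have hinv : ∀ u ∈ Icc (0 : ℝ) 1, |(d u)⁻¹| ≤ K := by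
      intro u hu
      rw [abs_inv]
      have h1 := abs_pos.2 (hd0 u hu)
      rw [inv_le_iff_one_le_mul₀ h1]
      exact (hd u hu).2
    have hmain := core j i δ γ w (fun u => f (a0 + ℓ * u)) (fun u => a0 + ℓ * u) (fun u => (d u)⁻¹)
      hj hi (by linarith) hji
      (by
        intro s hs t ht
        obtain ⟨ξ, h1, h2⟩ := (hst s hs t ht).2.2
        refine lift (abs_nonneg _) ?_ k2
        show |f (a0 + ℓ * s) - f (a0 + ℓ * t)| ≤ _
        rw [h2, abs_mul, mul_assoc]
        exact mul_le_mul (hd ξ (hsub s hs t ht ξ h1)).1 (hx1 s t) (abs_nonneg _) hK0.le)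
      (by
        intro s hs t ht
        obtain ⟨ξ, h1, h2⟩ := (hst s hs t ht).2.2
        refine lift (abs_nonneg _) ?_ k2
        show _ ≤ K * K * |f (a0 + ℓ * s) - f (a0 + ℓ * t)|
        rw [h2, abs_mul]
        have h3 := (hd ξ (hsub s hs t ht ξ h1)).2
        calc |s - t| ≤ K * |a0 + ℓ * s - (a0 + ℓ * t)| := hx2 s t
          _ ≤ K * ((K * |d ξ|) * |a0 + ℓ * s - (a0 + ℓ * t)|) := by
            apply mul_le_mul_of_nonneg_left _ hK0.le
            nlinarith [abs_nonneg (a0 + ℓ * s - (a0 + ℓ * t))]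
          _ = _ := by ring)
      (by
        intro s hs t ht
        refine lift (abs_nonneg _) ?_ hKw
        show |(d s)⁻¹ - (d t)⁻¹| ≤ _
        have h1 : (d s)⁻¹ - (d t)⁻¹ = (d s)⁻¹ * ((d t)⁻¹ * (d t - d s)) := by
          have := hd0 s hs
          have := hd0 t ht
          field_simp
        rw [h1, abs_mul, abs_mul, abs_sub_comm (d t)]
        calc _ ≤ K * (K * (K * |s - t|)) := by
              gcongr
              · exact hinv s hs
              · exact hinv t ht
              · exact (hst s hs t ht).1
          _ = _ := by ring)
      (by
        intro s hs t ht
        refine lift (abs_nonneg _) ?_ hKw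
        show _ ≤ K ^ 3 * |(d s)⁻¹ - (d t)⁻¹|
        have h1 : d s - d t = d s * (d t * ((d t)⁻¹ - (d s)⁻¹)) := by
          have := hd0 s hs
          have := hd0 t ht
          field_simp
        have h2 : |d s - d t| ≤ K * (K * |(d s)⁻¹ - (d t)⁻¹|) := by
          rw [h1, abs_mul, abs_mul, abs_sub_comm (d t)⁻¹]
          gcongr
          · exact (hd s hs).1
          · exact (hd t ht).1
        calc |s - t| ≤ K * |d s - d t| := (hst s hs t ht).2.1
          _ ≤ K * (K * (K * |(d s)⁻¹ - (d t)⁻¹|)) := by gcongr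
          _ = _ := by ring)
      (fun s hs => (hinv s hs).trans k1)
      (by
        intro s hs t ht
        obtain ⟨ξ, h1, h2⟩ := (hst s hs t ht).2.2
        refine ⟨ξ, h1, ?_⟩
        have := hd0 ξ (hsub s hs t ht ξ h1)
        show a0 + ℓ * s - (a0 + ℓ * t) = (d ξ)⁻¹ * (f (a0 + ℓ * s) - f (a0 + ℓ * t))
        rw [h2]
        field_simp) σ hσ hσ1
    intro h0
    apply hmain
    refine MeasureTheory.measure_mono_null ?_ h0
    rintro u ⟨hu1, hu2⟩
    exact ⟨hu1, badPair_swap _ _ _ _ _ _ hu2⟩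

theorem stmt0 (i j γ δ a b : ℝ) (f : ℝ → ℝ)
    (hi0 : 0 < i) (hi1 : i < 1) (hj0 : 0 < j) (hj1 : j < 1) (hij : i + j = 1)
    (hab : a < b)
    (hf : ContDiffOn ℝ 2 f (Set.Icc a b))
    (hf'' : ∀ x ∈ Set.Icc a b, iteratedDerivWithin 2 f (Set.Icc a b) x ≠ 0) :
    dimH (badPair i j (γ, δ) ∩ {p : ℝ × ℝ | ∃ x ∈ Set.Icc a b, p = (x, f x)}) = 1 := by
  apply le_antisymm
  · have h1 : badPair i j (γ, δ) ∩ {p : ℝ × ℝ | ∃ x ∈ Set.Icc a b, p = (x, f x)} ⊆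
        (fun x : ℝ => (x, f x)) '' (Icc a b) := by
      rintro p ⟨_, x, hx, rfl⟩
      exact ⟨x, hx, rfl⟩
    have h2 : ContDiffOn ℝ 1 (fun x : ℝ => (x, f x)) (Icc a b) :=
      contDiffOn_id.prodMk (hf.of_le (by norm_num))
    have h3 := h2.dimH_image_le (convex_Icc a b) (Subset.refl _)
    refine (dimH_mono h1).trans (h3.trans ?_)
    exact (dimH_mono (subset_univ _)).trans Real.dimH_univ.le
  · obtain ⟨a0, ℓ, hℓ, hmem, hs⟩ := core_curve i j γ δ a b f hi0 hj0 hij hab hf hf''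
    set U := {u : ℝ | u ∈ Icc (0 : ℝ) 1 ∧
        (a0 + ℓ * u, f (a0 + ℓ * u)) ∈ badPair i j (γ, δ)} with hU
    have hlip : LipschitzWith (Real.toNNReal (1 / ℓ)) (fun p : ℝ × ℝ => (p.1 - a0) / ℓ) := by
      apply LipschitzWith.of_dist_le_mul
      intro p q
      rw [Real.coe_toNNReal _ (by positivity), Real.dist_eq, Prod.dist_eq]
      rw [show (p.1 - a0) / ℓ - (q.1 - a0) / ℓ = 1 / ℓ * (p.1 - q.1) by ring, abs_mul,
        abs_of_pos (by positivity : 0 < 1 / ℓ)]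
      apply mul_le_mul_of_nonneg_left _ (by positivity)
      rw [← Real.dist_eq]
      exact le_max_left _ _
    have h1 : U ⊆ (fun p : ℝ × ℝ => (p.1 - a0) / ℓ) ''
        (badPair i j (γ, δ) ∩ {p : ℝ × ℝ | ∃ x ∈ Set.Icc a b, p = (x, f x)}) := by
      rintro u ⟨hu1, hu2⟩
      refine ⟨(a0 + ℓ * u, f (a0 + ℓ * u)), ⟨hu2, _, hmem u hu1, rfl⟩, ?_⟩
      show (a0 + ℓ * u - a0) / ℓ = u
      field_simp
      ring
    have h2 : (1 : ENNReal) ≤ dimH U := by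
      apply le_of_forall_lt
      intro c hc
      obtain ⟨r, hr1, hr2⟩ := ENNReal.lt_iff_exists_nnreal_btwn.1 hc
      have hr3 : r < 1 := by exact_mod_cast hr2
      have hr0 : 0 < r := by
        have := lt_of_le_of_lt (zero_le (a := c)) hr1
        exact_mod_cast this
      refine lt_of_lt_of_le hr1 ?_
      exact le_dimH_of_hausdorffMeasure_ne_zero (hs r (by exact_mod_cast hr0) (by exact_mod_cast hr3))
    exact h2.trans ((dimH_mono h1).trans (hlip.dimH_image_le _))
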